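/- There exist absolute constants c > 0 and C > 0 such that the following holds. Let F be a field and let P be a finite set of m points in F^2. If F has positive characteristic p, assume m ≤ c · p^{15/11}. If −1 is a square in F, assume additionally that Δ(P) ≠ {0}. Then there exists a point q ∈ P such that |Δ_q(P)| ≥ C · m^{8/15}. In particular, |Δ(P)| ≥ C · m^{8/15}. -/

import Mathlib

open scoped Classical

/-- The squared Euclidean distance between two points of `F^2`. -/
def sqDist {F : Type*} [Field F] (q r : F × F) : F :=
  (q.1 - r.1) ^ 2 + (q.2 - r.2) ^ 2

/-- The set of squared distances pinned at a point `q`. -/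
noncomputable def pinnedDists {F : Type*} [Field F] (q : F × F) (P : Finset (F × F)) :
    Finset F :=
  P.image (fun r => sqDist q r)

/-- The set of squared distances determined by a point set `P`. -/
noncomputable def allDists {F : Type*} [Field F] (P : Finset (F × F)) : Finset F :=
  (P ×ˢ P).image (fun qr => sqDist qr.1 qr.2)

section LinesInSpace

open MvPolynomial

variable {K : Type*} [Field K]

/-- The parametrised line on which the coordinate `0` equals `s * X + t`, the coordinate `i` is
the parameter `X`, and the remaining coordinate is the constant `a`, where `q = (a, s, t)`. -/
noncomputable def lineParam (i : Fin 3) (q : K × K × K) (j : Fin 3) : Polynomial K :=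
  if j = 0 then Polynomial.C q.2.1 * Polynomial.X + Polynomial.C q.2.2
  else if j = i then Polynomial.X else Polynomial.C q.1

/-- The restriction of a polynomial in three variables to the line `lineParam i q`. -/
noncomputable def restrictLine (i : Fin 3) (q : K × K × K) :
    MvPolynomial (Fin 3) K →ₐ[K] Polynomial K :=
  aeval (lineParam i q)

theorem natDegree_restrictLine_le (i : Fin 3) (q : K × K × K) (g : MvPolynomial (Fin 3) K) :
    (restrictLine i q g).natDegree ≤ g.totalDegree := by
  have := aeval_natDegree_le (n := 1) g le_rfl (lineParam i q) (by
    intro j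
    unfold lineParam
    split_ifs
    · compute_degree
    · exact Polynomial.natDegree_X_le
    · simp)
  simpa [restrictLine] using this

theorem derivative_restrictLine {i : Fin 3} (hi : i ≠ 0) (q : K × K × K)
    (g : MvPolynomial (Fin 3) K) :
    Polynomial.derivative (restrictLine i q g) =
      Polynomial.C q.2.1 * restrictLine i q (pderiv 0 g) + restrictLine i q (pderiv i g) := by
  induction g using MvPolynomial.induction_on with
  | C a => simp [restrictLine]
  | add p q hp hq => simp only [map_add, hp, hq]; ring
  | mul_X p j h =>
    have hX : Polynomial.derivative (lineParam i q j) =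
        Polynomial.C q.2.1 * restrictLine i q (pderiv 0 (X j)) +
          restrictLine i q (pderiv i (X j)) := by
      unfold lineParam
      by_cases hj : j = 0
      · subst hj; simp [hi.symm]
      · by_cases hji : j = i
        · subst hji; simp [hi]
        · simp [hj, hji]
    have e : restrictLine i q (X j) = lineParam i q j := by simp [restrictLine]
    simp only [map_mul, Derivation.leibniz, smul_eq_mul, map_add, Polynomial.derivative_mul, h,
      e, hX]
    ring

theorem polynomial_eval_aeval {σ : Type*} (f : σ → Polynomial K) (g : MvPolynomial σ K) (u : K) :
    (aeval f g).eval u = eval (fun j => (f j).eval u) g := by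
  induction g using MvPolynomial.induction_on with
  | C a => simp
  | add p q hp hq => simp only [map_add, Polynomial.eval_add, hp, hq]
  | mul_X p j h => simp only [map_mul, Polynomial.eval_mul, h, aeval_X, eval_X]

theorem eval_restrictLine (i : Fin 3) (q : K × K × K) (g : MvPolynomial (Fin 3) K) (u : K) :
    (restrictLine i q g).eval u = eval (fun j => (lineParam i q j).eval u) g :=
  polynomial_eval_aeval _ g u

/-- The incidence relation between the two families of lines. -/
def LinesMeet (l r : K × K × K) : Prop :=
  r.2.1 * l.1 + r.2.2 = l.2.1 * r.1 + l.2.2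

theorem LinesMeet.eval_eq {l r : K × K × K} (h : LinesMeet l r) (g : MvPolynomial (Fin 3) K) :
    (restrictLine 2 l g).eval r.1 = (restrictLine 1 r g).eval l.1 := by
  rw [eval_restrictLine, eval_restrictLine]
  congr 2
  funext j
  unfold LinesMeet at h
  fin_cases j <;> simp [lineParam, h]

theorem totalDegree_pderiv_le {σ : Type*} (i : σ) (g : MvPolynomial σ K) :
    (pderiv i g).totalDegree ≤ g.totalDegree := by
  conv_lhs => rw [g.as_sum, map_sum]
  refine (totalDegree_finsetSum _ _).trans (Finset.sup_le fun s hs => ?_)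
  rw [pderiv_monomial]
  refine (totalDegree_monomial_le _ _).trans ?_
  refine le_trans ?_ (le_totalDegree hs)
  have : s - Finsupp.single i 1 ≤ s := tsub_le_self
  exact Finsupp.degree_mono this

theorem finSuccEquiv_pderiv_zero {n : ℕ} (g : MvPolynomial (Fin (n + 1)) K) :
    finSuccEquiv K n (pderiv 0 g) = Polynomial.derivative (finSuccEquiv K n g) := by
  induction g using MvPolynomial.induction_on with
  | C a => simp [finSuccEquiv_apply]
  | add p q hp hq => simp only [map_add, hp, hq]
  | mul_X p j h =>
    simp only [map_mul, Derivation.leibniz, smul_eq_mul, map_add, Polynomial.derivative_mul, h]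
    have : finSuccEquiv K n (pderiv 0 (X j)) = Polynomial.derivative (finSuccEquiv K n (X j)) := by
      refine Fin.cases ?_ (fun j => ?_) j
      · simp [finSuccEquiv_X_zero]
      · simp [finSuccEquiv_X_succ, Fin.succ_ne_zero]
    rw [this]; ring

theorem natDegree_finSuccEquiv_eq_zero_of_pderiv_eq_zero {g : MvPolynomial (Fin 3) K}
    (hchar : ∀ n : ℕ, n ≠ 0 → n ≤ g.totalDegree → (n : K) ≠ 0) (h : pderiv 0 g = 0) :
    (finSuccEquiv K 2 g).natDegree = 0 := by
  by_contra hd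
  have hd' : (finSuccEquiv K 2 g).natDegree ≤ g.totalDegree := by
    rw [natDegree_finSuccEquiv]; exact degreeOf_le_totalDegree g 0
  have h1 := finSuccEquiv_pderiv_zero g
  rw [h, map_zero] at h1
  obtain ⟨m, hm⟩ := Nat.exists_eq_succ_of_ne_zero hd
  have h2 := congrArg (fun p => Polynomial.coeff p m) h1
  simp only [Polynomial.coeff_zero, Polynomial.coeff_derivative] at h2
  have h3 : (finSuccEquiv K 2 g).coeff (m + 1) ≠ 0 := by
    have : (finSuccEquiv K 2 g).leadingCoeff ≠ 0 := by
      rw [Ne, Polynomial.leadingCoeff_eq_zero]; rintro h; simp [h] at hd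
    rwa [Polynomial.leadingCoeff, hm] at this
  have h4 : ((m : MvPolynomial (Fin 2) K) + 1) = C ((m + 1 : ℕ) : K) := by simp
  rw [h4] at h2
  rcases mul_eq_zero.1 h2.symm with h5 | h5
  · exact h3 h5
  · rw [C_eq_zero] at h5
    exact hchar (m + 1) (by lia) (by lia) h5

theorem not_dvd_pderiv_zero {g : MvPolynomial (Fin 3) K} (h : pderiv 0 g ≠ 0) :
    ¬ g ∣ pderiv 0 g := by
  intro hd
  have h1 := map_dvd (finSuccEquiv K 2) hd
  rw [finSuccEquiv_pderiv_zero] at h1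
  have h0 : Polynomial.derivative (finSuccEquiv K 2 g) ≠ 0 := by
    rw [← finSuccEquiv_pderiv_zero]
    exact (map_ne_zero_iff _ (finSuccEquiv K 2).injective).2 h
  have h2 := Polynomial.natDegree_le_of_dvd h1 h0
  have h3 : (finSuccEquiv K 2 g).natDegree ≠ 0 := by
    intro h4
    rw [Polynomial.eq_C_of_natDegree_eq_zero h4] at h0
    simp at h0
  exact absurd (Polynomial.natDegree_derivative_lt h3) (by lia)

theorem card_le_totalDegree_of_vanish [Infinite K] {r : MvPolynomial (Fin 2) K} (hr : r ≠ 0)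
    (j₀ : Fin 2) (S : Finset K)
    (h : ∀ a ∈ S, aeval (fun j => if j = j₀ then Polynomial.C a else Polynomial.X) r = 0) :
    S.card ≤ r.totalDegree := by
  obtain ⟨v, hv⟩ : ∃ v, eval v r ≠ 0 := by
    by_contra! hall
    exact hr (MvPolynomial.funext fun v => by simpa using hall v)
  set p : Polynomial K :=
    aeval (fun j => if j = j₀ then Polynomial.X else Polynomial.C (v j)) r with hp
  have hpe : ∀ a, p.eval a = eval (fun j => if j = j₀ then a else v j) r := by
    intro a
    rw [hp, polynomial_eval_aeval]
    congr 2
    funext j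
    split_ifs <;> simp
  have hp0 : p ≠ 0 := by
    intro h0
    apply hv
    have := hpe (v j₀)
    rw [h0, Polynomial.eval_zero] at this
    rw [this]
    congr 2
    funext j
    split_ifs with hj <;> simp [hj]
  have hdeg : p.natDegree ≤ r.totalDegree := by
    have := aeval_natDegree_le (n := 1) r le_rfl
      (fun j => if j = j₀ then Polynomial.X else Polynomial.C (v j)) (by
        intro j
        split_ifs
        · exact Polynomial.natDegree_X_le
        · simp)
    simpa using this
  refine (Polynomial.card_le_degree_of_subset_roots (p := p) fun a ha => ?_).trans hdeg
  rw [Polynomial.mem_roots hp0, Polynomial.IsRoot, hpe]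
  obtain ⟨j₁, hj₁⟩ : ∃ j₁, ∀ j, j ≠ j₀ → j = j₁ := by
    refine ⟨j₀ + 1, fun j hj => ?_⟩
    have : ∀ i j : Fin 2, j ≠ i → j = i + 1 := by decide
    exact this _ _ hj
  have h2 := congrArg (Polynomial.eval (v j₁)) (h a ha)
  rw [polynomial_eval_aeval, Polynomial.eval_zero] at h2
  rw [← h2]
  congr 2
  funext j
  split_ifs with hj
  · simp
  · simp [hj₁ j hj]

end LinesInSpace

section Bezout

open MvPolynomial

variable {K : Type*} [Field K]

theorem Polynomial.resultant_ne_zero_of_prime {R : Type*} [CommRing R] [IsDomain R]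
    {g h : Polynomial R} (hg : Prime g) (hgh : ¬ g ∣ h) :
    g.resultant h ≠ 0 := by
  intro h0
  have hinj : Function.Injective
      (Polynomial.sylvesterMap g h (le_refl g.natDegree) (le_refl h.natDegree)) := by
    rw [injective_iff_map_eq_zero]
    rintro ⟨⟨p, hp⟩, ⟨q, hq⟩⟩ hpq
    have h1 : g * q + h * p = 0 := by
      simpa [Polynomial.sylvesterMap] using congrArg Subtype.val hpq
    have hdvd : g ∣ h * p := ⟨-q, by linear_combination h1⟩
    have hp0 : p = 0 := by
      rcases hg.dvd_or_dvd hdvd with h2 | h2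
      · exact absurd h2 hgh
      · by_contra hp0
        have := Polynomial.natDegree_le_of_dvd h2 hp0
        rw [Polynomial.mem_degreeLT] at hp
        rw [Polynomial.degree_eq_natDegree hp0] at hp
        have : p.natDegree < g.natDegree := by exact_mod_cast hp
        lia
    subst hp0
    have hq0 : q = 0 := by
      rw [mul_zero, add_zero] at h1
      exact (mul_eq_zero.1 h1).resolve_left hg.ne_zero
    subst hq0
    rfl
  rw [Polynomial.resultant, ← Matrix.exists_mulVec_eq_zero_iff] at h0
  obtain ⟨v, hv, hv0⟩ := h0
  rw [← Polynomial.toMatrix_sylvesterMap' g h le_rfl le_rfl] at hv0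
  set b := ((Polynomial.degreeLT.basis R g.natDegree).prod
    (Polynomial.degreeLT.basis R h.natDegree)).reindex finSumFinEquiv
  have hx : v = b.repr (b.equivFun.symm v) := by
    rw [← Module.Basis.equivFun_apply, LinearEquiv.apply_symm_apply]
  rw [hx, LinearMap.toMatrix_mulVec_repr] at hv0
  have h1 := (Polynomial.degreeLT.basis R (g.natDegree + h.natDegree)).repr.map_eq_zero_iff.1
    (DFunLike.coe_injective hv0)
  have h2 := (injective_iff_map_eq_zero _).1 hinj _ h1
  exact hv (b.equivFun.symm.map_eq_zero_iff.1 h2)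

theorem totalDegree_det_le {σ n : Type*} [Fintype n] [DecidableEq n]
    (M : Matrix n n (MvPolynomial σ K)) (D : ℕ) (hM : ∀ i j, (M i j).totalDegree ≤ D) :
    M.det.totalDegree ≤ Fintype.card n * D := by
  rw [Matrix.det_apply]
  refine (totalDegree_finsetSum _ _).trans (Finset.sup_le fun s _ => ?_)
  have h1 : (Equiv.Perm.sign s • ∏ i, M (s i) i).totalDegree = (∏ i, M (s i) i).totalDegree := by
    rcases Int.units_eq_one_or (Equiv.Perm.sign s) with h | h <;> simp [h, Units.smul_def]
  rw [h1]
  refine (totalDegree_finsetProd _ _).trans ?_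
  refine (Finset.sum_le_card_nsmul _ _ D fun i _ => hM _ _).trans ?_
  simp

theorem finSuccEquiv_symm_C {n : ℕ} (r : MvPolynomial (Fin n) K) :
    (finSuccEquiv K n).symm (Polynomial.C r) = rename Fin.succ r := by
  rw [AlgEquiv.symm_apply_eq]
  induction r using MvPolynomial.induction_on with
  | C a => simp [finSuccEquiv_apply]
  | add p q hp hq => simp only [map_add, hp, hq]
  | mul_X p j hp => rw [map_mul, map_mul, hp, map_mul, rename_X, finSuccEquiv_X_succ]

theorem totalDegree_coeff_finSuccEquiv_le {n : ℕ} (f : MvPolynomial (Fin (n + 1)) K) (i : ℕ) :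
    ((finSuccEquiv K n f).coeff i).totalDegree ≤ f.totalDegree := by
  by_cases h0 : (finSuccEquiv K n f).coeff i = 0
  · simp [h0]
  · exact le_trans (Nat.le_add_right _ _) (totalDegree_coeff_finSuccEquiv_add_le f i h0)

theorem exists_eq_rename_succ {n : ℕ} {g : MvPolynomial (Fin (n + 1)) K}
    (hd : (finSuccEquiv K n g).natDegree = 0) :
    ∃ r : MvPolynomial (Fin n) K, r.totalDegree ≤ g.totalDegree ∧ g = rename Fin.succ r := by
  refine ⟨_, totalDegree_coeff_finSuccEquiv_le g 0, ?_⟩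
  rw [← finSuccEquiv_symm_C, ← Polynomial.eq_C_of_natDegree_eq_zero hd,
    AlgEquiv.symm_apply_apply]

/-- Elimination of the coordinate `0` between an irreducible polynomial and a polynomial that it
does not divide. -/
theorem exists_elimination {g h : MvPolynomial (Fin 3) K} (hg : Irreducible g) (hgh : ¬ g ∣ h) :
    ∃ r : MvPolynomial (Fin 2) K, r ≠ 0 ∧
      r.totalDegree ≤ (g.totalDegree + h.totalDegree) * (g.totalDegree + h.totalDegree) ∧
      ∃ u v, g * u + h * v = rename Fin.succ r := by
  set e := finSuccEquiv K 2 with he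
  by_cases hd : (e g).natDegree = 0
  · obtain ⟨r, hr, hgr⟩ := exists_eq_rename_succ hd
    refine ⟨r, ?_, hr.trans ((Nat.le_add_right _ _).trans (Nat.le_mul_self _)), 1, 0, ?_⟩
    · rintro rfl
      exact hg.ne_zero (by simpa using hgr)
    · rw [← hgr]; ring
  have hpr : Prime (e g) := by
    rw [MulEquiv.prime_iff]; exact hg.prime
  have hnd : ¬ e g ∣ e h := by
    intro hdv
    exact hgh ((map_dvd_iff e).1 hdv)
  refine ⟨(e g).resultant (e h), Polynomial.resultant_ne_zero_of_prime hpr hnd, ?_, ?_⟩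
  · have hnd : ∀ f, (e f).natDegree ≤ f.totalDegree := fun f => by
      rw [he, natDegree_finSuccEquiv]; exact degreeOf_le_totalDegree f 0
    refine (totalDegree_det_le _ (g.totalDegree + h.totalDegree) fun i j => ?_).trans ?_
    · rw [Polynomial.sylvester, Matrix.of_apply]
      refine Fin.addCases (fun j => ?_) (fun j => ?_) j
      · rw [Fin.addCases_left]
        split_ifs
        · exact (totalDegree_coeff_finSuccEquiv_le _ _).trans (Nat.le_add_left _ _)
        · simp
      · rw [Fin.addCases_right]
        split_ifs
        · exact (totalDegree_coeff_finSuccEquiv_le _ _).trans (Nat.le_add_right _ _)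
        · simp
    · rw [Fintype.card_fin]
      exact Nat.mul_le_mul_right _ (add_le_add (hnd g) (hnd h))
  · obtain ⟨p, q, -, -, hpq⟩ := Polynomial.exists_mul_add_mul_eq_C_resultant (e g) (e h)
      le_rfl le_rfl (Or.inl hd)
    refine ⟨e.symm p, e.symm q, ?_⟩
    rw [← finSuccEquiv_symm_C, ← hpq]
    simp [he]

theorem card_lines_le_of_rename [Infinite K] {r : MvPolynomial (Fin 2) K} (hr : r ≠ 0)
    {i : Fin 3} (hi : i ≠ 0) (L : Finset (K × K × K))
    (hL : Set.InjOn Prod.fst (L : Set (K × K × K)))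
    (h : ∀ q ∈ L, restrictLine i q (rename Fin.succ r) = 0) : L.card ≤ r.totalDegree := by
  rw [← Finset.card_image_of_injOn hL]
  obtain ⟨j₀, hj₀⟩ : ∃ j₀ : Fin 2, ∀ j : Fin 2, j = j₀ ↔ j.succ ≠ i := by
    have : ∀ i : Fin 3, i ≠ 0 → ∃ j₀ : Fin 2, ∀ j : Fin 2, j = j₀ ↔ j.succ ≠ i := by decide
    exact this i hi
  refine card_le_totalDegree_of_vanish hr j₀ _ fun a ha => ?_
  obtain ⟨q, hq, rfl⟩ := Finset.mem_image.1 ha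
  rw [← h q hq, restrictLine, aeval_rename]
  congr 2
  funext j
  simp only [Function.comp, lineParam, Fin.succ_ne_zero, if_false, hj₀]
  split_ifs <;> simp_all

/-- A Bézout-type bound for lines common to two surfaces. -/
theorem card_lines_le [Infinite K] {g h : MvPolynomial (Fin 3) K} (hg : Irreducible g)
    (hgh : ¬ g ∣ h) {i : Fin 3} (hi : i ≠ 0) (L : Finset (K × K × K))
    (hL : Set.InjOn Prod.fst (L : Set (K × K × K)))
    (hLg : ∀ q ∈ L, restrictLine i q g = 0) (hLh : ∀ q ∈ L, restrictLine i q h = 0) :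
    L.card ≤ (g.totalDegree + h.totalDegree) * (g.totalDegree + h.totalDegree) := by
  obtain ⟨r, hr, hdeg, u, v, huv⟩ := exists_elimination hg hgh
  refine le_trans (card_lines_le_of_rename hr hi L hL fun q hq => ?_) hdeg
  rw [← huv, map_add, map_mul, map_mul, hLg q hq, hLh q hq, zero_mul, zero_mul, zero_add]

/-- A polynomial without the coordinate `0` contains few lines. -/
theorem card_lines_le_of_natDegree_eq_zero [Infinite K] {g : MvPolynomial (Fin 3) K} (hg : g ≠ 0)
    (hd : (finSuccEquiv K 2 g).natDegree = 0) {i : Fin 3} (hi : i ≠ 0) (L : Finset (K × K × K))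
    (hL : Set.InjOn Prod.fst (L : Set (K × K × K)))
    (hLg : ∀ q ∈ L, restrictLine i q g = 0) : L.card ≤ g.totalDegree := by
  obtain ⟨r, hr, rfl⟩ := exists_eq_rename_succ hd
  exact (card_lines_le_of_rename (by rintro rfl; simp at hg) hi L hL hLg).trans hr

end Bezout

section Ode

open Polynomial

variable {K : Type*} [Field K]

/-- Uniqueness for a linear second order differential equation for polynomials. -/
theorem eq_zero_of_ode {h A B Z : K[X]} {c : K} (hZ : Z.eval c ≠ 0)
    (hode : Z ^ 2 * derivative (derivative h) = h * A + derivative h * B)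
    (h0 : h.eval c = 0) (h1 : (derivative h).eval c = 0)
    (hchar : ∀ n : ℕ, n ≠ 0 → n ≤ h.natDegree → (n : K) ≠ 0) : h = 0 := by
  by_contra hne
  obtain ⟨u, hu, huc⟩ := Polynomial.exists_eq_pow_rootMultiplicity_mul_and_not_dvd h hne c
  set n := h.rootMultiplicity c with hn
  have hn2 : 2 ≤ n := by
    rw [hn]
    exact (Polynomial.one_lt_rootMultiplicity_iff_isRoot hne).2 ⟨h0, h1⟩
  have hnd : n ≤ h.natDegree := by
    have h2 := congrArg natDegree hu
    have hu0 : u ≠ 0 := by rintro rfl; simp at huc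
    rw [natDegree_mul (pow_ne_zero _ (X_sub_C_ne_zero c)) hu0, natDegree_pow,
      natDegree_X_sub_C] at h2
    omega
  obtain ⟨k, hk⟩ : ∃ k, n = k + 2 := ⟨n - 2, by omega⟩
  have huc' : u.eval c ≠ 0 := fun h => huc (dvd_iff_isRoot.2 h)
  rw [hk] at hu hnd
  have hd1 : derivative h = (X - C c) ^ (k + 1) * (((k + 2 : ℕ) : K[X]) * u +
      (X - C c) * derivative u) := by
    rw [hu]
    simp only [derivative_mul, derivative_X_sub_C_pow, map_natCast, Nat.add_succ_sub_one]
    push_cast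
    ring
  have hd2 : derivative (derivative h) = (X - C c) ^ k * (((k + 2 : ℕ) : K[X]) *
      ((k + 1 : ℕ) : K[X]) * u + (X - C c) * (2 * ((k + 2 : ℕ) : K[X]) * derivative u
        + (X - C c) * derivative (derivative u))) := by
    rw [hd1]
    simp only [derivative_mul, derivative_X_sub_C_pow, derivative_add, map_natCast,
      derivative_natCast, derivative_X_sub_C, Nat.add_succ_sub_one]
    push_cast
    ring
  have key : (X - C c) ^ k * (Z ^ 2 * (((k + 2 : ℕ) : K[X]) *
      ((k + 1 : ℕ) : K[X]) * u + (X - C c) * (2 * ((k + 2 : ℕ) : K[X]) * derivative u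
        + (X - C c) * derivative (derivative u)))) = (X - C c) ^ k * ((X - C c) * ((X - C c) * u * A
        + (((k + 2 : ℕ) : K[X]) * u + (X - C c) * derivative u) * B)) := by
    rw [hd2, hd1, hu] at hode
    linear_combination hode
  have key2 := mul_left_cancel₀ (pow_ne_zero k (X_sub_C_ne_zero c)) key
  have key3 := congrArg (eval c) key2
  simp only [eval_mul, eval_add, eval_sub, eval_X, eval_C, sub_self, zero_mul, add_zero,
    eval_pow, eval_natCast] at key3
  exact mul_ne_zero (pow_ne_zero 2 hZ) (mul_ne_zero (mul_ne_zero (hchar _ (by omega) hnd)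
    (hchar (k + 1) (by omega) (by omega))) huc') key3

end Ode

section Ruling

open MvPolynomial

variable {K : Type*} [Field K]

/-- A polynomial vanishing on every line of the family `i` contained in the zero set of `g`. -/
noncomputable def ruling (i : Fin 3) (g : MvPolynomial (Fin 3) K) : MvPolynomial (Fin 3) K :=
  pderiv i (pderiv i g) * pderiv 0 g ^ 2 - 2 * (pderiv 0 (pderiv i g) * pderiv i g * pderiv 0 g)
    + pderiv 0 (pderiv 0 g) * pderiv i g ^ 2

theorem totalDegree_ruling_le (i : Fin 3) (g : MvPolynomial (Fin 3) K) :
    (ruling i g).totalDegree ≤ 3 * g.totalDegree := by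
  have h1 : ∀ j, (pderiv j g).totalDegree ≤ g.totalDegree := fun j => totalDegree_pderiv_le j g
  have h2 : ∀ j k, (pderiv j (pderiv k g)).totalDegree ≤ g.totalDegree := fun j k =>
    (totalDegree_pderiv_le j _).trans (h1 k)
  have hsq : ∀ f : MvPolynomial (Fin 3) K, f.totalDegree ≤ g.totalDegree →
      (f ^ 2).totalDegree ≤ 2 * g.totalDegree := fun f hf =>
    (totalDegree_pow f 2).trans (Nat.mul_le_mul_left 2 hf)
  have hm : ∀ (f f' : MvPolynomial (Fin 3) K) (a b : ℕ), f.totalDegree ≤ a → f'.totalDegree ≤ b →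
      (f * f').totalDegree ≤ a + b := fun f f' a b ha hb =>
    (totalDegree_mul f f').trans (add_le_add ha hb)
  refine (totalDegree_add _ _).trans (max_le ((totalDegree_sub _ _).trans (max_le ?_ ?_)) ?_)
  · exact (hm _ _ _ _ (h2 i i) (hsq _ (h1 0))).trans (by lia)
  · have h0 : (2 : MvPolynomial (Fin 3) K).totalDegree ≤ 0 := by
      rw [show (2 : MvPolynomial (Fin 3) K) = C 2 from (map_ofNat C 2).symm, totalDegree_C]
    exact (hm _ _ _ _ h0 (hm _ _ _ _ (hm _ _ _ _ (h2 0 i) (h1 i)) (h1 0))).trans (by lia)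
  · exact (hm _ _ _ _ (h2 0 0) (hsq _ (h1 i))).trans (by lia)

theorem pderiv_pderiv_comm {σ R : Type*} [CommRing R] (i j : σ) (g : MvPolynomial σ R) :
    pderiv i (pderiv j g) = pderiv j (pderiv i g) := by
  have h : ⁅(pderiv i : Derivation R (MvPolynomial σ R) (MvPolynomial σ R)),
      (pderiv j : Derivation R (MvPolynomial σ R) (MvPolynomial σ R))⁆ = 0 := by
    refine derivation_ext fun k => ?_
    rw [Derivation.commutator_apply]
    simp only [pderiv_X, Pi.single_apply]
    split_ifs <;> simp
  have h1 := congrArg (fun D : Derivation R (MvPolynomial σ R) (MvPolynomial σ R) => D g) h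
  rw [Derivation.commutator_apply] at h1
  exact sub_eq_zero.1 h1

theorem derivative_derivative_restrictLine {i : Fin 3} (hi : i ≠ 0) (q : K × K × K)
    (g : MvPolynomial (Fin 3) K) :
    Polynomial.derivative (Polynomial.derivative (restrictLine i q g)) =
      Polynomial.C q.2.1 ^ 2 * restrictLine i q (pderiv 0 (pderiv 0 g))
      + 2 * Polynomial.C q.2.1 * restrictLine i q (pderiv 0 (pderiv i g))
      + restrictLine i q (pderiv i (pderiv i g)) := by
  rw [derivative_restrictLine hi, Polynomial.derivative_add, Polynomial.derivative_C_mul,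
    derivative_restrictLine hi, derivative_restrictLine hi, pderiv_pderiv_comm i 0]
  ring

theorem restrictLine_ruling {i : Fin 3} (hi : i ≠ 0) (q : K × K × K)
    {g : MvPolynomial (Fin 3) K} (hg : restrictLine i q g = 0) :
    restrictLine i q (ruling i g) = 0 := by
  have h1 := derivative_restrictLine hi q g
  have h2 := derivative_derivative_restrictLine hi q g
  rw [hg, Polynomial.derivative_zero] at h1 h2
  rw [Polynomial.derivative_zero] at h2
  simp only [ruling, map_add, map_sub, map_mul, map_pow, map_ofNat]
  have h3 : restrictLine i q (pderiv i g) =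
      - (Polynomial.C q.2.1 * restrictLine i q (pderiv 0 g)) := by linear_combination -h1
  rw [h3]
  linear_combination -(restrictLine i q (pderiv 0 g)) ^ 2 * h2

/-- If `g` divides its ruling polynomial then a line tangent to the zero set of `g` at a point
where it is a graph is contained in the zero set. -/
theorem restrictLine_eq_zero_of_dvd_ruling {i : Fin 3} (hi : i ≠ 0) {q : K × K × K}
    {g : MvPolynomial (Fin 3) K} (hdvd : g ∣ ruling i g)
    (hchar : ∀ n : ℕ, n ≠ 0 → n ≤ g.totalDegree → (n : K) ≠ 0) {u : K}
    (h0 : (restrictLine i q g).eval u = 0)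
    (h1 : q.2.1 * (restrictLine i q (pderiv 0 g)).eval u
      + (restrictLine i q (pderiv i g)).eval u = 0)
    (hz : (restrictLine i q (pderiv 0 g)).eval u ≠ 0) : restrictLine i q g = 0 := by
  obtain ⟨w, hw⟩ := hdvd
  have h2 := congrArg (restrictLine i q) hw
  simp only [ruling, map_add, map_sub, map_mul, map_pow, map_ofNat] at h2
  have hd := derivative_restrictLine hi q g
  refine eq_zero_of_ode (A := restrictLine i q w)
    (B := 2 * restrictLine i q (pderiv 0 (pderiv i g)) * restrictLine i q (pderiv 0 g)
      - restrictLine i q (pderiv 0 (pderiv 0 g)) * Polynomial.derivative (restrictLine i q g)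
      + 2 * Polynomial.C q.2.1 * restrictLine i q (pderiv 0 g) *
        restrictLine i q (pderiv 0 (pderiv 0 g)))
    (Z := restrictLine i q (pderiv 0 g)) (c := u) hz ?_ h0 ?_ ?_
  · rw [derivative_derivative_restrictLine hi]
    have h3 : restrictLine i q (pderiv i g) = Polynomial.derivative (restrictLine i q g)
      - (Polynomial.C q.2.1 * restrictLine i q (pderiv 0 g)) := by linear_combination -hd
    rw [h3] at h2
    linear_combination h2
  · rw [hd]; simpa using h1
  · exact fun n hn hn' => hchar n hn (hn'.trans (natDegree_restrictLine_le i q g))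

end Ruling

section DoublyRuled

open MvPolynomial

variable {K : Type*} [Field K]

theorem restrictLine_pderiv_ruling {i : Fin 3} (hi : i ≠ 0) (j : Fin 3) (q : K × K × K)
    {g : MvPolynomial (Fin 3) K} (hg : restrictLine i q g = 0) :
    restrictLine i q (pderiv j (ruling i g)) =
      restrictLine i q (pderiv 0 g) ^ 2 *
        Polynomial.derivative (Polynomial.derivative (restrictLine i q (pderiv j g)))
      - 2 * restrictLine i q (pderiv 0 g) *
        Polynomial.derivative (restrictLine i q (pderiv 0 g)) *
        Polynomial.derivative (restrictLine i q (pderiv j g)) := by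
  have h1 := derivative_restrictLine hi q g
  have h2 := derivative_derivative_restrictLine hi q g
  rw [hg, Polynomial.derivative_zero] at h1 h2
  rw [Polynomial.derivative_zero] at h2
  rw [derivative_derivative_restrictLine hi, derivative_restrictLine hi q (pderiv 0 g),
    derivative_restrictLine hi q (pderiv j g)]
  have e2 : pderiv j (2 : MvPolynomial (Fin 3) K) = 0 := (pderiv j).map_natCast 2
  simp only [ruling, map_add, map_sub, pderiv_mul, Derivation.leibniz_pow, e2, map_mul, map_pow,
    smul_eq_mul, nsmul_eq_mul, Nat.add_one_sub_one, pow_one, zero_mul, map_ofNat,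
    zero_add, Nat.cast_ofNat]
  rw [pderiv_pderiv_comm j i (pderiv i g), pderiv_pderiv_comm j i g, pderiv_pderiv_comm j 0 g,
    pderiv_pderiv_comm j 0 (pderiv i g), pderiv_pderiv_comm j 0 (pderiv 0 g),
    pderiv_pderiv_comm j 0 g, pderiv_pderiv_comm j i g, pderiv_pderiv_comm i 0 g]
  have h3 : restrictLine i q (pderiv i g) =
      - (Polynomial.C q.2.1 * restrictLine i q (pderiv 0 g)) := by linear_combination -h1
  have h4 : restrictLine i q (pderiv i (pderiv i g)) =
      - (Polynomial.C q.2.1 ^ 2 * restrictLine i q (pderiv 0 (pderiv 0 g))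
      + 2 * Polynomial.C q.2.1 * restrictLine i q (pderiv 0 (pderiv i g))) := by
    linear_combination -h2
  rw [h3, h4]
  ring

theorem restrictLine_ode {i : Fin 3} (hi : i ≠ 0) (j : Fin 3) (q : K × K × K)
    {g : MvPolynomial (Fin 3) K} (hdvd : g ∣ ruling i g) (hg : restrictLine i q g = 0)
    (hz : restrictLine i q (pderiv 0 g) ≠ 0) :
    restrictLine i q (pderiv 0 g) ^ 2 *
        Polynomial.derivative (Polynomial.derivative (restrictLine i q (pderiv j g)))
      = restrictLine i q (pderiv j g) * (restrictLine i q (pderiv 0 g) *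
        Polynomial.derivative (Polynomial.derivative (restrictLine i q (pderiv 0 g)))
        - 2 * Polynomial.derivative (restrictLine i q (pderiv 0 g)) ^ 2) +
        Polynomial.derivative (restrictLine i q (pderiv j g)) *
        (2 * restrictLine i q (pderiv 0 g) *
          Polynomial.derivative (restrictLine i q (pderiv 0 g))) := by
  obtain ⟨w, hw⟩ := hdvd
  have key : ∀ k, restrictLine i q (pderiv k (ruling i g)) =
      restrictLine i q (pderiv k g) * restrictLine i q w := fun k => by
    rw [hw, pderiv_mul, map_add, map_mul, map_mul, hg, zero_mul, add_zero]
  have h0 := key 0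
  have h1 := key j
  rw [restrictLine_pderiv_ruling hi _ q hg] at h0 h1
  refine mul_left_cancel₀ hz ?_
  linear_combination restrictLine i q (pderiv 0 g) * h1 - restrictLine i q (pderiv j g) * h0

/-- On a line contained in a doubly ruled surface the tangent planes vary projectively. -/
theorem exists_restrictLine_pderiv_eq {i : Fin 3} (hi : i ≠ 0) (j : Fin 3) (q : K × K × K)
    {g : MvPolynomial (Fin 3) K} (hdvd : g ∣ ruling i g) (hg : restrictLine i q g = 0)
    (hchar : ∀ n : ℕ, n ≠ 0 → n ≤ g.totalDegree + 1 → (n : K) ≠ 0) {c : K}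
    (hz : (restrictLine i q (pderiv 0 g)).eval c ≠ 0) :
    ∃ α β : K, restrictLine i q (pderiv j g) =
      -((Polynomial.C α * Polynomial.X + Polynomial.C β) * restrictLine i q (pderiv 0 g)) := by
  have hz' : restrictLine i q (pderiv 0 g) ≠ 0 := by rintro h; simp [h] at hz
  have h1 := restrictLine_ode hi j q hdvd hg hz'
  have hdeg : ∀ k, (restrictLine i q (pderiv k g)).natDegree ≤ g.totalDegree := fun k =>
    (natDegree_restrictLine_le i q _).trans (totalDegree_pderiv_le k g)
  have hdj := hdeg j
  have hd0 := hdeg 0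
  generalize restrictLine i q (pderiv j g) = Y at *
  generalize restrictLine i q (pderiv 0 g) = Z at *
  set μ := -(Y.eval c) / Z.eval c with hμ
  set α := -((Polynomial.derivative Y).eval c + μ * (Polynomial.derivative Z).eval c) / Z.eval c
    with hα
  refine ⟨α, μ - α * c, ?_⟩
  rw [eq_neg_iff_add_eq_zero]
  refine eq_zero_of_ode (A := Z * Polynomial.derivative (Polynomial.derivative Z)
    - 2 * Polynomial.derivative Z ^ 2) (B := 2 * Z * Polynomial.derivative Z) (Z := Z) (c := c)
    hz ?_ ?_ ?_ ?_
  · simp only [Polynomial.derivative_add, Polynomial.derivative_mul, Polynomial.derivative_C,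
      Polynomial.derivative_X, Polynomial.derivative_zero, Polynomial.derivative_one]
    linear_combination h1
  · simp only [Polynomial.eval_add, Polynomial.eval_mul, Polynomial.eval_C, Polynomial.eval_X]
    rw [hμ]; field_simp; ring
  · simp only [Polynomial.derivative_add, Polynomial.derivative_mul, Polynomial.derivative_C,
      Polynomial.derivative_X, Polynomial.eval_add, Polynomial.eval_mul, Polynomial.eval_C,
      Polynomial.eval_X, zero_mul, zero_add, mul_one, add_zero]
    have h2 : α * Z.eval c = -((Polynomial.derivative Y).eval c
        + μ * (Polynomial.derivative Z).eval c) := div_mul_cancel₀ _ hz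
    linear_combination h2
  · intro n hn hn'
    refine hchar n hn (hn'.trans ?_)
    refine (Polynomial.natDegree_add_le _ _).trans (max_le (by lia) ?_)
    refine Polynomial.natDegree_mul_le.trans ?_
    have := Polynomial.natDegree_linear_le (a := α) (b := μ - α * c)
    lia

end DoublyRuled

section Quadric

open MvPolynomial

variable {K : Type*} [Field K]

/-- The quadric `z = α x y + β x + γ y + δ`. -/
noncomputable def quadric (α β γ δ : K) : MvPolynomial (Fin 3) K :=
  X 0 - (C α * X 1 * X 2 + C β * X 1 + C γ * X 2 + C δ)

theorem finSuccEquiv_quadric (α β γ δ : K) : finSuccEquiv K 2 (quadric α β γ δ) =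
    Polynomial.X - Polynomial.C (C α * X 0 * X 1 + C β * X 0 + C γ * X 1 + C δ) := by
  have h1 : finSuccEquiv K 2 (X 1) = Polynomial.C (X 0) := finSuccEquiv_X_succ (j := 0)
  have h2 : finSuccEquiv K 2 (X 2) = Polynomial.C (X 1) := finSuccEquiv_X_succ (j := 1)
  have hC : ∀ a : K, finSuccEquiv K 2 (C a) = Polynomial.C (C a) := fun a => by
    simp [finSuccEquiv_apply]
  simp only [quadric, map_sub, map_add, map_mul, h1, h2, hC, finSuccEquiv_X_zero]

theorem eval_finSuccEquiv_two (g : MvPolynomial (Fin 3) K) (q : MvPolynomial (Fin 2) K) :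
    (finSuccEquiv K 2 g).eval q = aeval ![q, X 0, X 1] g := by
  have h1 : finSuccEquiv K 2 (X 1) = Polynomial.C (X 0) := finSuccEquiv_X_succ (j := 0)
  have h2 : finSuccEquiv K 2 (X 2) = Polynomial.C (X 1) := finSuccEquiv_X_succ (j := 1)
  induction g using MvPolynomial.induction_on with
  | C a => simp [finSuccEquiv_apply, algebraMap_eq]
  | add p q hp hq => simp only [map_add, Polynomial.eval_add, hp, hq]
  | mul_X p j hp =>
    rw [map_mul, map_mul, Polynomial.eval_mul, hp, aeval_X]
    fin_cases j <;> simp [finSuccEquiv_X_zero, h1, h2]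

theorem eval_aeval_eq {σ τ : Type*} (f : σ → MvPolynomial τ K) (v : τ → K)
    (g : MvPolynomial σ K) : eval v (aeval f g) = eval (fun j => eval v (f j)) g := by
  induction g using MvPolynomial.induction_on with
  | C a => simp [algebraMap_eq]
  | add p q hp hq => simp only [map_add, hp, hq]
  | mul_X p j hp => rw [map_mul, map_mul, map_mul, hp, aeval_X, eval_X]

theorem quadric_dvd [Infinite K] {g : MvPolynomial (Fin 3) K} {α β γ δ : K} {Z : Polynomial K}
    (hZ : Z ≠ 0)
    (h : ∀ x y, Z.eval y ≠ 0 → eval ![α * x * y + β * x + γ * y + δ, x, y] g = 0) :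
    quadric α β γ δ ∣ g := by
  rw [← map_dvd_iff (finSuccEquiv K 2), finSuccEquiv_quadric, Polynomial.dvd_iff_isRoot,
    Polynomial.IsRoot, eval_finSuccEquiv_two]
  set q : MvPolynomial (Fin 2) K := C α * X 0 * X 1 + C β * X 0 + C γ * X 1 + C δ with hq
  obtain ⟨c, hc⟩ : ∃ c, Z.eval c ≠ 0 := by
    by_contra! h0
    exact hZ (Polynomial.funext fun r => by simpa using h0 r)
  have hZ' : Polynomial.aeval (X 1 : MvPolynomial (Fin 2) K) Z ≠ 0 := by
    intro h0
    apply hc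
    have := congrArg (eval ![0, c]) h0
    rw [← MvPolynomial.coe_aeval_eq_eval, RingHom.coe_coe, ← Polynomial.aeval_algHom_apply] at this
    simpa using this
  refine (mul_eq_zero.1 (?_ : _ * Polynomial.aeval (X 1 : MvPolynomial (Fin 2) K) Z = 0)
    ).resolve_right hZ'
  refine MvPolynomial.funext fun v => ?_
  have hv1 : eval v (Polynomial.aeval (X 1 : MvPolynomial (Fin 2) K) Z) = Z.eval (v 1) := by
    rw [← MvPolynomial.coe_aeval_eq_eval, RingHom.coe_coe, ← Polynomial.aeval_algHom_apply]
    simp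
  have hv2 : eval v (aeval ![q, X 0, X 1] g) =
      eval ![α * v 0 * v 1 + β * v 0 + γ * v 1 + δ, v 0, v 1] g := by
    rw [eval_aeval_eq]
    congr 2
    funext j
    fin_cases j <;> simp [q]
  rw [map_mul, hv1, hv2, map_zero]
  by_cases h0 : Z.eval (v 1) = 0
  · rw [h0, mul_zero]
  · rw [h _ _ h0, zero_mul]

/-- An irreducible doubly ruled surface is a quadric. -/
theorem exists_quadric_dvd [Infinite K] {g : MvPolynomial (Fin 3) K}
    (hchar : ∀ n : ℕ, n ≠ 0 → n ≤ g.totalDegree + 1 → (n : K) ≠ 0)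
    (h2 : g ∣ ruling 2 g) (h1 : g ∣ ruling 1 g) {P : Fin 3 → K} (hP : eval P g = 0)
    (hPz : eval P (pderiv 0 g) ≠ 0) : ∃ α β γ δ : K, quadric α β γ δ ∣ g := by
  have hchar' : ∀ n : ℕ, n ≠ 0 → n ≤ g.totalDegree → (n : K) ≠ 0 := fun n hn hn' =>
    hchar n hn (by lia)
  set s := -(eval P (pderiv 2 g)) / eval P (pderiv 0 g) with hs
  set q : K × K × K := (P 1, s, P 0 - s * P 2) with hq
  have hpt : ∀ f, (restrictLine 2 q f).eval (P 2) = eval P f := fun f => by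
    rw [eval_restrictLine]
    congr 2
    funext j
    fin_cases j <;> simp [lineParam, hq]
  have hline : restrictLine 2 q g = 0 := by
    refine restrictLine_eq_zero_of_dvd_ruling (by decide) h2 hchar' (u := P 2) ?_ ?_ ?_
    · rw [hpt, hP]
    · rw [hpt, hpt, hq, hs]; field_simp; ring
    · rwa [hpt]
  obtain ⟨α, β, hαβ⟩ := exists_restrictLine_pderiv_eq (by decide) 1 q h2 hline hchar
    (c := P 2) (by rwa [hpt])
  have hZ : restrictLine 2 q (pderiv 0 g) ≠ 0 := by
    rintro h
    apply hPz
    rw [← hpt, h, Polynomial.eval_zero]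
  refine ⟨α, β, s - α * P 1, q.2.2 - β * P 1, quadric_dvd hZ fun x y hy => ?_⟩
  set r : K × K × K := (y, α * y + β, s * y + q.2.2 - (α * y + β) * P 1) with hr
  have hmeet : LinesMeet q r := by
    simp only [LinesMeet, hr, hq]; ring
  have hrline : restrictLine 1 r g = 0 := by
    refine restrictLine_eq_zero_of_dvd_ruling (by decide) h1 hchar' (u := P 1) ?_ ?_ ?_
    · rw [← hmeet.eval_eq g, hline, Polynomial.eval_zero]
    · rw [← hmeet.eval_eq, ← hmeet.eval_eq, hαβ]
      simp only [Polynomial.eval_neg, Polynomial.eval_mul, Polynomial.eval_add, Polynomial.eval_C,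
        Polynomial.eval_X]
      ring
    · rwa [← hmeet.eval_eq]
  have h3 := eval_restrictLine 1 r g x
  rw [hrline, Polynomial.eval_zero] at h3
  rw [h3]
  congr 2
  funext j
  fin_cases j
  · simp [lineParam, hr, hq]; ring
  · simp [lineParam]
  · simp [lineParam, hr]

theorem dvd_quadric {g : MvPolynomial (Fin 3) K} (hg : Irreducible g) {α β γ δ : K}
    (h : quadric α β γ δ ∣ g) : g ∣ quadric α β γ δ := by
  refine Irreducible.dvd_symm (Prime.irreducible ?_) hg h
  rw [← MulEquiv.prime_iff (finSuccEquiv K 2), finSuccEquiv_quadric]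
  exact Polynomial.prime_X_sub_C _

theorem eq_of_restrictLine_two_quadric {α β γ δ : K} {q : K × K × K}
    (h : restrictLine 2 q (quadric α β γ δ) = 0) :
    q.2.1 = α * q.1 + γ ∧ q.2.2 = β * q.1 + δ := by
  have h1 : Polynomial.C (q.2.1 - (α * q.1 + γ)) * Polynomial.X +
      Polynomial.C (q.2.2 - (β * q.1 + δ)) = 0 := by
    rw [← h]
    simp [restrictLine, quadric, lineParam]
    ring
  have h2 := congrArg (fun p => Polynomial.coeff p 1) h1
  have h3 := congrArg (fun p => Polynomial.coeff p 0) h1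
  simp at h2 h3
  exact ⟨sub_eq_zero.1 h2, sub_eq_zero.1 h3⟩

theorem eq_of_restrictLine_one_quadric {α β γ δ : K} {q : K × K × K}
    (h : restrictLine 1 q (quadric α β γ δ) = 0) :
    q.2.1 = α * q.1 + β ∧ q.2.2 = γ * q.1 + δ := by
  have h1 : Polynomial.C (q.2.1 - (α * q.1 + β)) * Polynomial.X +
      Polynomial.C (q.2.2 - (γ * q.1 + δ)) = 0 := by
    rw [← h]
    simp [restrictLine, quadric, lineParam]
    ring
  have h2 := congrArg (fun p => Polynomial.coeff p 1) h1
  have h3 := congrArg (fun p => Polynomial.coeff p 0) h1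
  simp at h2 h3
  exact ⟨sub_eq_zero.1 h2, sub_eq_zero.1 h3⟩

end Quadric

section Counting

open MvPolynomial

/-- The number of related pairs between two finite sets. -/
noncomputable def edgeCount {α β : Type*} (G : α → β → Prop) (L : Finset α) (R : Finset β) : ℕ :=
  ∑ r ∈ R, (L.filter fun l => G l r).card

section EdgeCount

variable {α β : Type*} {G : α → β → Prop} {L L' : Finset α} {R R' : Finset β}

theorem edgeCount_eq_sum_left : edgeCount G L R = ∑ l ∈ L, (R.filter fun r => G l r).card :=
  (Finset.sum_card_bipartiteAbove_eq_sum_card_bipartiteBelow G).symm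

theorem edgeCount_le_mul_card_right {k : ℕ} (h : ∀ r ∈ R, (L.filter fun l => G l r).card ≤ k) :
    edgeCount G L R ≤ k * R.card := by
  rw [mul_comm]
  exact Finset.sum_le_card_nsmul _ _ _ h

theorem edgeCount_le_mul_card_left {k : ℕ} (h : ∀ l ∈ L, (R.filter fun r => G l r).card ≤ k) :
    edgeCount G L R ≤ k * L.card := by
  rw [mul_comm, edgeCount_eq_sum_left]
  exact Finset.sum_le_card_nsmul _ _ _ h

theorem edgeCount_union_right [DecidableEq β] (h : Disjoint R R') :
    edgeCount G L (R ∪ R') = edgeCount G L R + edgeCount G L R' :=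
  Finset.sum_union h

theorem edgeCount_union_left [DecidableEq α] (h : Disjoint L L') :
    edgeCount G (L ∪ L') R = edgeCount G L R + edgeCount G L' R := by
  simp only [edgeCount_eq_sum_left, Finset.sum_union h]

theorem exists_split [DecidableEq α] (L : Finset α) (p : α → Prop) :
    ∃ L₁ L₂, Disjoint L₁ L₂ ∧ L = L₁ ∪ L₂ ∧ (∀ l ∈ L₁, p l) ∧ ∀ l ∈ L₂, ¬ p l :=
  ⟨L.filter p, L.filter fun l => ¬ p l, Finset.disjoint_filter_filter_not _ _ _,
    (Finset.filter_union_filter_not_eq p L).symm,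
    fun _ hl => (Finset.mem_filter.1 hl).2, fun _ hl => (Finset.mem_filter.1 hl).2⟩

end EdgeCount

variable {K : Type*} {G : K × K × K → K × K × K → Prop}

/-- The incidences between lines on a surface are carried by few lines, up to controlled terms. -/
def Reducible (G : K × K × K → K × K × K → Prop) (k d : ℕ) (L R : Finset (K × K × K)) : Prop :=
  ∃ L' ⊆ L, ∃ R' ⊆ R, L'.card ≤ 16 * d ^ 2 ∧ R'.card ≤ 16 * d ^ 2 ∧
    edgeCount G L R + k * R'.card ≤ edgeCount G L' R' + 3 * d * (L.card + R.card) + k * R.card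

theorem reducible_self {k d : ℕ} {L R : Finset (K × K × K)} (hL : L.card ≤ 16 * d ^ 2)
    (hR : R.card ≤ 16 * d ^ 2) : Reducible G k d L R :=
  ⟨L, Finset.Subset.refl _, R, Finset.Subset.refl _, hL, hR, by lia⟩

variable [Field K]

/-- Every right line on a quadric meets at most `k` left lines on that quadric. -/
def QuadricBound (G : K × K × K → K × K × K → Prop) (k : ℕ) (L R : Finset (K × K × K)) : Prop :=
  ∀ α β γ δ : K, ∀ r ∈ R, r.2.1 = α * r.1 + β → r.2.2 = γ * r.1 + δ →
    (L.filter fun l => G l r ∧ l.2.1 = α * l.1 + γ ∧ l.2.2 = β * l.1 + δ).card ≤ k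

theorem QuadricBound.mono {k : ℕ} {L L' R R' : Finset (K × K × K)} (h : QuadricBound G k L R)
    (hL : L' ⊆ L) (hR : R' ⊆ R) : QuadricBound G k L' R' := fun α β γ δ r hr h1 h2 =>
  (Finset.card_le_card (Finset.filter_subset_filter _ hL)).trans (h α β γ δ r (hR hr) h1 h2)

theorem card_roots_image_le {S : Finset (K × K × K)} (hS : Set.InjOn Prod.fst (S : Set (K × K × K)))
    {p : Polynomial K} (hp : p ≠ 0) {d : ℕ} (hd : p.natDegree ≤ d) (h : ∀ q ∈ S, p.eval q.1 = 0) :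
    S.card ≤ d := by
  rw [← Finset.card_image_of_injOn hS]
  refine le_trans ?_ ((Polynomial.card_roots' p).trans hd)
  refine le_trans (Finset.card_le_card (t := p.roots.toFinset) fun a ha => ?_)
    (Multiset.toFinset_card_le _)
  obtain ⟨q, hq, rfl⟩ := Finset.mem_image.1 ha
  rw [Multiset.mem_toFinset, Polynomial.mem_roots hp]
  exact h q hq

theorem card_left_meet_le (hG : ∀ l r, G l r → LinesMeet l r) {L : Finset (K × K × K)}
    (hL : Set.InjOn Prod.fst (L : Set (K × K × K))) {h : MvPolynomial (Fin 3) K} {d : ℕ}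
    (hd : h.totalDegree ≤ d)
    (hLh : ∀ l ∈ L, restrictLine 2 l h = 0) {r : K × K × K} (hr : restrictLine 1 r h ≠ 0) :
    (L.filter fun l => G l r).card ≤ d := by
  refine card_roots_image_le (hL.mono (Finset.coe_subset.2 (Finset.filter_subset _ _))) hr
    ((natDegree_restrictLine_le 1 r h).trans hd) fun q hq => ?_
  rw [Finset.mem_filter] at hq
  rw [← (hG _ _ hq.2).eval_eq, hLh q hq.1, Polynomial.eval_zero]

theorem card_right_meet_le (hG : ∀ l r, G l r → LinesMeet l r) {R : Finset (K × K × K)}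
    (hR : Set.InjOn Prod.fst (R : Set (K × K × K))) {h : MvPolynomial (Fin 3) K} {d : ℕ}
    (hd : h.totalDegree ≤ d)
    (hRh : ∀ r ∈ R, restrictLine 1 r h = 0) {l : K × K × K} (hl : restrictLine 2 l h ≠ 0) :
    (R.filter fun r => G l r).card ≤ d := by
  refine card_roots_image_le (hR.mono (Finset.coe_subset.2 (Finset.filter_subset _ _))) hl
    ((natDegree_restrictLine_le 2 l h).trans hd) fun q hq => ?_
  rw [Finset.mem_filter] at hq
  rw [(hG _ _ hq.2).eval_eq, hRh q hq.1, Polynomial.eval_zero]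

theorem reducible_of_irreducible [Infinite K] (hG : ∀ l r, G l r → LinesMeet l r) {k : ℕ}
    {L R : Finset (K × K × K)} (hQ : QuadricBound G k L R)
    (hL : Set.InjOn Prod.fst (L : Set (K × K × K))) (hR : Set.InjOn Prod.fst (R : Set (K × K × K)))
    {g : MvPolynomial (Fin 3) K} (hg : Irreducible g)
    (hchar : ∀ n : ℕ, n ≠ 0 → n ≤ g.totalDegree + 1 → (n : K) ≠ 0)
    (hLg : ∀ l ∈ L, restrictLine 2 l g = 0) (hRg : ∀ r ∈ R, restrictLine 1 r g = 0) :
    Reducible G k g.totalDegree L R := by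
  set d := g.totalDegree with hd
  have i1 : (1 : Fin 3) ≠ 0 := by decide
  have i2 : (2 : Fin 3) ≠ 0 := by decide
  have hsq : d ≤ 16 * d ^ 2 := by nlinarith
  by_cases hz : pderiv 0 g = 0
  · have h0 := natDegree_finSuccEquiv_eq_zero_of_pderiv_eq_zero
      (fun n hn hn' => hchar n hn (by lia)) hz
    exact reducible_self
      ((card_lines_le_of_natDegree_eq_zero hg.ne_zero h0 i2 L hL hLg).trans hsq)
      ((card_lines_le_of_natDegree_eq_zero hg.ne_zero h0 i1 R hR hRg).trans hsq)
  have hle : ∀ h : MvPolynomial (Fin 3) K, h.totalDegree ≤ 3 * d →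
      (d + h.totalDegree) * (d + h.totalDegree) ≤ 16 * d ^ 2 := fun h hh => by
    have : d + h.totalDegree ≤ 4 * d := by lia
    calc _ ≤ (4 * d) * (4 * d) := Nat.mul_le_mul this this
      _ = _ := by ring
  by_cases hW2 : g ∣ ruling 2 g
  swap
  · have hdW := totalDegree_ruling_le 2 g
    have hLW : ∀ l ∈ L, restrictLine 2 l (ruling 2 g) = 0 := fun l hl =>
      restrictLine_ruling i2 l (hLg l hl)
    obtain ⟨R', R₂, hdisj, rfl, hR', hR₂⟩ := exists_split R
      fun r => restrictLine 1 r (ruling 2 g) = 0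
    have hRsub : R' ⊆ R' ∪ R₂ := Finset.subset_union_left
    refine ⟨L, Finset.Subset.refl _, R', hRsub,
      (card_lines_le hg hW2 i2 L hL hLg hLW).trans (hle _ hdW),
      (card_lines_le hg hW2 i1 R' (hR.mono (Finset.coe_subset.2 hRsub))
        (fun r hr => hRg r (hRsub hr)) hR').trans (hle _ hdW), ?_⟩
    rw [edgeCount_union_right hdisj, Finset.card_union_of_disjoint hdisj]
    have h1 : edgeCount G L R₂ ≤ 3 * d * R₂.card := edgeCount_le_mul_card_right
      fun r hr => card_left_meet_le hG hL hdW hLW (hR₂ r hr)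
    nlinarith
  by_cases hW1 : g ∣ ruling 1 g
  swap
  · have hdW := totalDegree_ruling_le 1 g
    have hRW : ∀ r ∈ R, restrictLine 1 r (ruling 1 g) = 0 := fun r hr =>
      restrictLine_ruling i1 r (hRg r hr)
    obtain ⟨L', L₂, hdisj, rfl, hL', hL₂⟩ := exists_split L
      fun l => restrictLine 2 l (ruling 1 g) = 0
    have hLsub : L' ⊆ L' ∪ L₂ := Finset.subset_union_left
    refine ⟨L', hLsub, R, Finset.Subset.refl _,
      (card_lines_le hg hW1 i2 L' (hL.mono (Finset.coe_subset.2 hLsub))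
        (fun l hl => hLg l (hLsub hl)) hL').trans (hle _ hdW),
      (card_lines_le hg hW1 i1 R hR hRg hRW).trans (hle _ hdW), ?_⟩
    rw [edgeCount_union_left hdisj, Finset.card_union_of_disjoint hdisj]
    have h1 : edgeCount G L₂ R ≤ 3 * d * L₂.card := edgeCount_le_mul_card_left
      fun l hl => card_right_meet_le hG hR hdW hRW (hL₂ l hl)
    nlinarith
  by_cases hall : (∀ l ∈ L, restrictLine 2 l (pderiv 0 g) = 0) ∧
      ∀ r ∈ R, restrictLine 1 r (pderiv 0 g) = 0
  · have hnd := not_dvd_pderiv_zero hz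
    have hd0 := totalDegree_pderiv_le 0 g
    exact reducible_self
      ((card_lines_le hg hnd i2 L hL hLg hall.1).trans (hle _ (by lia)))
      ((card_lines_le hg hnd i1 R hR hRg hall.2).trans (hle _ (by lia)))
  obtain ⟨i, q, hq, hqz⟩ : ∃ (i : Fin 3) (q : K × K × K), restrictLine i q g = 0 ∧
      restrictLine i q (pderiv 0 g) ≠ 0 := by
    by_contra! hcon
    exact hall ⟨fun l hl => hcon _ _ (hLg l hl), fun r hr => hcon _ _ (hRg r hr)⟩
  obtain ⟨u, hu⟩ : ∃ u, (restrictLine i q (pderiv 0 g)).eval u ≠ 0 := by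
    by_contra! h0
    exact hqz (Polynomial.funext fun r => by simpa using h0 r)
  have hP := eval_restrictLine i q g u
  rw [hq, Polynomial.eval_zero] at hP
  rw [eval_restrictLine] at hu
  obtain ⟨α, β, γ, δ, hdvd⟩ := exists_quadric_dvd hchar hW2 hW1 hP.symm hu
  obtain ⟨w, hw⟩ := dvd_quadric hg hdvd
  have hL2 : ∀ l ∈ L, l.2.1 = α * l.1 + γ ∧ l.2.2 = β * l.1 + δ := fun l hl =>
    eq_of_restrictLine_two_quadric (by rw [hw, map_mul, hLg l hl, zero_mul])
  have hR2 : ∀ r ∈ R, r.2.1 = α * r.1 + β ∧ r.2.2 = γ * r.1 + δ := fun r hr =>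
    eq_of_restrictLine_one_quadric (by rw [hw, map_mul, hRg r hr, zero_mul])
  refine ⟨∅, Finset.empty_subset _, ∅, Finset.empty_subset _, by simp, by simp, ?_⟩
  have h1 : edgeCount G L R ≤ k * R.card := edgeCount_le_mul_card_right fun r hr => by
    refine (Finset.card_le_card fun l hl => ?_).trans
      (hQ α β γ δ r hr (hR2 r hr).1 (hR2 r hr).2)
    rw [Finset.mem_filter] at hl ⊢
    exact ⟨hl.1, hl.2, hL2 l hl.1⟩
  simp only [Finset.card_empty, mul_zero]
  lia

theorem reducible_of_ne_zero [Infinite K] (hG : ∀ l r, G l r → LinesMeet l r) {k : ℕ}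
    (f : MvPolynomial (Fin 3) K) : f ≠ 0 →
    (∀ n : ℕ, n ≠ 0 → n ≤ f.totalDegree + 1 → (n : K) ≠ 0) →
    ∀ L R : Finset (K × K × K), QuadricBound G k L R →
    Set.InjOn Prod.fst (L : Set (K × K × K)) → Set.InjOn Prod.fst (R : Set (K × K × K)) →
    (∀ l ∈ L, restrictLine 2 l f = 0) → (∀ r ∈ R, restrictLine 1 r f = 0) →
    Reducible G k f.totalDegree L R := by
  induction f using WfDvdMonoid.induction_on_irreducible with
  | zero => exact fun h => absurd rfl h
  | unit u hu =>
    intro _ _ L R _ _ _ hLu hRu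
    have hL0 : L = ∅ := Finset.eq_empty_of_forall_notMem fun l hl =>
      (hu.map (restrictLine 2 l)).ne_zero (hLu l hl)
    have hR0 : R = ∅ := Finset.eq_empty_of_forall_notMem fun r hr =>
      (hu.map (restrictLine 1 r)).ne_zero (hRu r hr)
    exact reducible_self (by simp [hL0]) (by simp [hR0])
  | mul f g hf hg ih =>
    intro _ hchar L R hQ hL hR hLf hRf
    rw [totalDegree_mul_of_isDomain hg.ne_zero hf] at hchar ⊢
    obtain ⟨L₁, L₂, hdL, rfl, hL₁, hL₂⟩ := exists_split L fun l => restrictLine 2 l g = 0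
    obtain ⟨R₁, R₂, hdR, rfl, hR₁, hR₂⟩ := exists_split R fun r => restrictLine 1 r g = 0
    have sL₁ : L₁ ⊆ L₁ ∪ L₂ := Finset.subset_union_left
    have sL₂ : L₂ ⊆ L₁ ∪ L₂ := Finset.subset_union_right
    have sR₁ : R₁ ⊆ R₁ ∪ R₂ := Finset.subset_union_left
    have sR₂ : R₂ ⊆ R₁ ∪ R₂ := Finset.subset_union_right
    have iL₁ := hL.mono (Finset.coe_subset.2 sL₁)
    have iR₁ := hR.mono (Finset.coe_subset.2 sR₁)
    obtain ⟨L₁', tL₁, R₁', tR₁, cL₁, cR₁, e₁⟩ := reducible_of_irreducible hG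
      (hQ.mono sL₁ sR₁) iL₁ iR₁ hg (fun n hn hn' => hchar n hn (by lia)) hL₁ hR₁
    obtain ⟨L₂', tL₂, R₂', tR₂, cL₂, cR₂, e₂⟩ := ih hf
      (fun n hn hn' => hchar n hn (by lia)) L₂ R₂ (hQ.mono sL₂ sR₂)
      (hL.mono (Finset.coe_subset.2 sL₂)) (hR.mono (Finset.coe_subset.2 sR₂))
      (fun l hl => by
        have := hLf l (sL₂ hl)
        rw [map_mul] at this
        exact (mul_eq_zero.1 this).resolve_left (hL₂ l hl))
      (fun r hr => by
        have := hRf r (sR₂ hr)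
        rw [map_mul] at this
        exact (mul_eq_zero.1 this).resolve_left (hR₂ r hr))
    have h₁ : edgeCount G L₁ R₂ ≤ g.totalDegree * R₂.card := edgeCount_le_mul_card_right
      fun r hr => card_left_meet_le hG iL₁ le_rfl hL₁ (hR₂ r hr)
    have h₂ : edgeCount G L₂ R₁ ≤ g.totalDegree * L₂.card := edgeCount_le_mul_card_left
      fun l hl => card_right_meet_le hG iR₁ le_rfl hR₁ (hL₂ l hl)
    have hdL' : Disjoint L₁' L₂' := hdL.mono tL₁ tL₂
    have hdR' : Disjoint R₁' R₂' := hdR.mono tR₁ tR₂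
    have hcard : ∀ a b : ℕ, 16 * a ^ 2 + 16 * b ^ 2 ≤ 16 * (a + b) ^ 2 := fun a b => by
      nlinarith [Nat.zero_le (a * b)]
    refine ⟨L₁' ∪ L₂', Finset.union_subset_union tL₁ tL₂, R₁' ∪ R₂',
      Finset.union_subset_union tR₁ tR₂, ?_, ?_, ?_⟩
    · rw [Finset.card_union_of_disjoint hdL']
      exact (add_le_add cL₁ cL₂).trans (hcard _ _)
    · rw [Finset.card_union_of_disjoint hdR']
      exact (add_le_add cR₁ cR₂).trans (hcard _ _)
    · rw [Finset.card_union_of_disjoint hdR', Finset.card_union_of_disjoint hdR,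
        Finset.card_union_of_disjoint hdL, edgeCount_union_left hdL', edgeCount_union_right hdR',
        edgeCount_union_right hdR', edgeCount_union_left hdL, edgeCount_union_right hdR,
        edgeCount_union_right hdR]
      have p₁ := Nat.zero_le (g.totalDegree * L₂.card)
      have p₂ := Nat.zero_le (g.totalDegree * R₂.card)
      have p₃ := Nat.zero_le (f.totalDegree * L₁.card)
      have p₄ := Nat.zero_le (f.totalDegree * R₁.card)
      linarith

end Counting

section Parameter

open MvPolynomial

variable {K : Type*} [Field K]

/-- Parameter counting: few lines lie on a surface of small degree. -/
theorem exists_vanishing_polynomial (i : Fin 3) (S : Finset (K × K × K)) (N : ℕ)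
    (hS : S.card * (3 * N + 1) < (N + 1) ^ 3) :
    ∃ f : MvPolynomial (Fin 3) K, f ≠ 0 ∧ f.totalDegree ≤ 3 * N ∧
      ∀ q ∈ S, restrictLine i q f = 0 := by
  set e : (Fin 3 → Fin (N + 1)) → Fin 3 →₀ ℕ := fun v =>
    Finsupp.equivFunOnFinite.symm fun j => (v j : ℕ) with he
  have he_inj : Function.Injective e := by
    intro v w h
    funext j
    have := DFunLike.congr_fun h j
    simpa [he, Fin.val_inj] using this
  set b : (Fin 3 → Fin (N + 1)) → MvPolynomial (Fin 3) K := fun v => monomial (e v) 1 with hb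
  have hli : LinearIndependent K b := by
    have := (basisMonomials (Fin 3) K).linearIndependent.comp e he_inj
    simpa [Function.comp_def] using this
  set Φ : ((Fin 3 → Fin (N + 1)) → K) →ₗ[K] (S → Fin (3 * N + 1) → K) :=
    LinearMap.pi fun q => LinearMap.pi fun t => (Polynomial.lcoeff K t).comp
      ((restrictLine i q.1).toLinearMap.comp (Fintype.linearCombination K b)) with hΦ
  obtain ⟨c, hc, hc0⟩ := Submodule.exists_mem_ne_zero_of_ne_bot
    (LinearMap.ker_ne_bot_of_finrank_lt (f := Φ) (by
      rw [Module.finrank_pi_fintype]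
      simpa using hS))
  have hdeg : (Fintype.linearCombination K b c).totalDegree ≤ 3 * N := by
    rw [Fintype.linearCombination_apply]
    refine totalDegree_finsetSum_le fun v _ => (totalDegree_smul_le _ _).trans ?_
    refine (totalDegree_monomial_le _ _).trans ?_
    rw [Finsupp.sum_fintype _ _ (fun _ => rfl), Fin.sum_univ_three]
    simp only [he, Finsupp.equivFunOnFinite_symm_apply_apply, id]
    have := (v 0).is_lt
    have := (v 1).is_lt
    have := (v 2).is_lt
    lia
  refine ⟨Fintype.linearCombination K b c, ?_, hdeg, fun q hq => ?_⟩
  · intro h0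
    rw [Fintype.linearCombination_apply] at h0
    exact hc0 (funext fun v => Fintype.linearIndependent_iff.1 hli c h0 v)
  · ext t
    rw [Polynomial.coeff_zero]
    by_cases ht : t < 3 * N + 1
    · exact congrFun (congrFun (LinearMap.mem_ker.1 hc) ⟨q, hq⟩) ⟨t, ht⟩
    · refine Polynomial.coeff_eq_zero_of_natDegree_lt
        (((natDegree_restrictLine_le i q _).trans hdeg).trans_lt (by lia))

end Parameter

section LineIncidences

open MvPolynomial

theorem edgeCount_le_of_forall_small {α β : Type*} [DecidableEq β] {G : α → β → Prop}
    {L : Finset α} {s T k : ℕ} (hs : 0 < s) (R : Finset β)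
    (h : ∀ S ⊆ R, S.card ≤ s → edgeCount G L S ≤ T + k * S.card) :
    edgeCount G L R ≤ (R.card / s + 1) * T + k * R.card := by
  induction R using Finset.strongInduction with
  | H R ih =>
    rcases le_or_gt R.card s with hR | hR
    · exact (h R (Finset.Subset.refl _) hR).trans
        (Nat.add_le_add_right (Nat.le_mul_of_pos_left _ (Nat.succ_pos _)) _)
    obtain ⟨S, hSR, hS⟩ := Finset.exists_subset_card_eq hR.le
    have hdisj : Disjoint S (R \ S) := Finset.disjoint_sdiff
    have hss : R \ S ⊂ R := Finset.sdiff_ssubset hSR (Finset.card_pos.1 (by lia))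
    have h1 := h S hSR hS.le
    have h2 := ih _ hss fun S' hS' => h S' (hS'.trans hss.subset)
    have h3 := Finset.card_sdiff_add_card_eq_card hSR
    have h4 : R.card / s = (R \ S).card / s + 1 := by
      rw [← h3, hS, Nat.add_div_right _ hs]
    calc edgeCount G L R = edgeCount G L S + edgeCount G L (R \ S) := by
          rw [← edgeCount_union_right hdisj, Finset.union_sdiff_of_subset hSR]
      _ ≤ (T + k * S.card) + (((R \ S).card / s + 1) * T + k * (R \ S).card) :=
          add_le_add h1 h2
      _ = (R.card / s + 1) * T + k * R.card := by rw [h4, ← h3]; ring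

theorem group_count_bound {n j C T g : ℕ} (hj : 0 < j) (hjn : 93312 * j ≤ n)
    (hnj : n ≤ 2 * (93312 * j)) (hC : C = 252 * 93312) (hT : T ≤ 63 * j * n ^ 2 + C * (36 * j) ^ 3)
    (hg : g ≤ n ^ 2 / (3 * j ^ 2) + 1) : g * T ≤ C * n ^ 3 := by
  have hn : 0 < n := by lia
  have h0 : 3 * j ^ 2 * (n ^ 2 / (3 * j ^ 2)) ≤ n ^ 2 := Nat.mul_div_le _ _
  have h1 : (93312 * j) ^ 2 ≤ n ^ 2 := Nat.pow_le_pow_left hjn 2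
  have h2 : g * j ^ 2 ≤ n ^ 2 := by
    have := Nat.mul_le_mul_right (j ^ 2) hg
    nlinarith
  have h3 : g * (63 * j * n ^ 2) ≤ 126 * 93312 * n ^ 3 := by
    refine Nat.le_of_mul_le_mul_left ?_ hn
    calc n * (g * (63 * j * n ^ 2)) ≤ 2 * (93312 * j) * (g * (63 * j * n ^ 2)) :=
          Nat.mul_le_mul_right _ hnj
      _ = 126 * 93312 * n ^ 2 * (g * j ^ 2) := by ring
      _ ≤ 126 * 93312 * n ^ 2 * n ^ 2 := Nat.mul_le_mul_left _ h2
      _ = n * (126 * 93312 * n ^ 3) := by ring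
  have h4 : 2 * (g * (C * (36 * j) ^ 3)) ≤ C * n ^ 3 := by
    calc 2 * (g * (C * (36 * j) ^ 3)) = C * (93312 * j) * (g * j ^ 2) := by ring
      _ ≤ C * n * n ^ 2 := Nat.mul_le_mul (Nat.mul_le_mul_left _ hjn) h2
      _ = C * n ^ 3 := by ring
  have h5 := Nat.mul_le_mul_left g hT
  subst hC
  lia

variable {K : Type*} [Field K]

/-- Incidences between two families of lines in space, if few of them lie on a quadric. -/
theorem edgeCount_lines_le [Infinite K] {G : K × K × K → K × K × K → Prop}
    (hG : ∀ l r, G l r → LinesMeet l r) {k : ℕ} (n : ℕ) :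
    (∀ i : ℕ, i ≠ 0 → i ≤ n → (i : K) ≠ 0) → ∀ L R : Finset (K × K × K), QuadricBound G k L R →
    Set.InjOn Prod.fst (L : Set (K × K × K)) → Set.InjOn Prod.fst (R : Set (K × K × K)) →
    L.card ≤ n ^ 2 → R.card ≤ n ^ 2 →
    edgeCount G L R ≤ 252 * 93312 * n ^ 3 + k * R.card := by
  induction n using Nat.strong_induction_on with
  | _ n ih =>
  intro hchar L R hQ hL hR cL cR
  rcases lt_or_ge n 93312 with hn | hn
  · have h1 : edgeCount G L R ≤ n ^ 2 * R.card := edgeCount_le_mul_card_right fun r _ =>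
      (Finset.card_filter_le _ _).trans cL
    have h2 := Nat.mul_le_mul_left (n ^ 2) cR
    have h3 := Nat.mul_le_mul_right (n ^ 3) hn.le
    have h4 : n ^ 2 * n ^ 2 = n * n ^ 3 := by ring
    lia
  obtain ⟨j, hj, hjn, hnj⟩ : ∃ j, 0 < j ∧ 93312 * j ≤ n ∧ n ≤ 2 * (93312 * j) :=
    ⟨n / 93312, by lia, by lia, by lia⟩
  have hjn2 : (93312 * j) ^ 2 ≤ n ^ 2 := Nat.pow_le_pow_left hjn 2
  have key := edgeCount_le_of_forall_small (G := G) (L := L) (k := k) (s := 3 * j ^ 2)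
    (T := 63 * j * n ^ 2 + 252 * 93312 * (36 * j) ^ 3) (by positivity) R ?_
  · refine key.trans (Nat.add_le_add_right (group_count_bound hj hjn hnj rfl le_rfl ?_) _)
    exact Nat.add_le_add_right (Nat.div_le_div_right cR) 1
  intro S hSR hS
  obtain ⟨f, hf0, hfd, hfS⟩ := exists_vanishing_polynomial 1 S (3 * j) (by
    calc S.card * (3 * (3 * j) + 1) ≤ 3 * j ^ 2 * (3 * (3 * j) + 1) := Nat.mul_le_mul_right _ hS
      _ < (3 * j + 1) ^ 3 := by nlinarith)
  obtain ⟨L₁, L₂, hdL, rfl, hL₁, hL₂⟩ := exists_split L fun l => restrictLine 2 l f = 0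
  have sL₁ : L₁ ⊆ L₁ ∪ L₂ := Finset.subset_union_left
  have iS := hR.mono (Finset.coe_subset.2 hSR)
  have iL₁ := hL.mono (Finset.coe_subset.2 sL₁)
  have hQ₁ := hQ.mono sL₁ hSR
  have h₂ : edgeCount G L₂ S ≤ 3 * (3 * j) * L₂.card := edgeCount_le_mul_card_left fun l hl =>
    card_right_meet_le hG iS hfd hfS (hL₂ l hl)
  obtain ⟨L', hL', R', hR', cL', cR', h₁⟩ := reducible_of_ne_zero hG f hf0
    (fun i hi hi' => hchar i hi (by lia)) L₁ S hQ₁ iL₁ iS hL₁ hfS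
  have hd2 : 16 * f.totalDegree ^ 2 ≤ (36 * j) ^ 2 := by
    have := Nat.pow_le_pow_left hfd 2
    nlinarith
  have h₃ := ih (36 * j) (by lia) (fun i hi hi' => hchar i hi (by lia)) L' R' (hQ₁.mono hL' hR')
    (iL₁.mono (Finset.coe_subset.2 hL')) (iS.mono (Finset.coe_subset.2 hR'))
    (cL'.trans hd2) (cR'.trans hd2)
  rw [edgeCount_union_left hdL]
  rw [Finset.card_union_of_disjoint hdL] at cL
  have h₄ : 3 * f.totalDegree * (L₁.card + S.card) ≤ 3 * (3 * (3 * j)) * (L₁.card + S.card) :=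
    Nat.mul_le_mul_right _ (by lia)
  have h₅ : j * S.card ≤ j * n ^ 2 := Nat.mul_le_mul_left _ (by nlinarith)
  have h₆ := Nat.mul_le_mul_left j cL
  have h₇ := Nat.zero_le (j * L₁.card)
  have h₈ := Nat.zero_le (j * L₂.card)
  nlinarith

end LineIncidences

section CartesianIncidences

open Polynomial

theorem coeff_eq_zero_of_cubic_add {F : Type*} [Field F] {a b c d : F} {f : F[X]}
    (h : C a + C b * X + C c * X ^ 2 + C d * X ^ 3 + f * X ^ 4 = 0) :
    a = 0 ∧ b = 0 ∧ c = 0 ∧ d = 0 := by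
  have h0 := congrArg (fun g => coeff g 0) h
  have h1 := congrArg (fun g => coeff g 1) h
  have h2 := congrArg (fun g => coeff g 2) h
  have h3 := congrArg (fun g => coeff g 3) h
  simp [coeff_X, coeff_C, coeff_X_pow, coeff_mul_X_pow'] at h0 h1 h2 h3
  exact ⟨h0, h1, h2, h3⟩

variable {F K : Type*} [Field F] [Field K] [Algebra F[X] K]

local notation "ι" => algebraMap (Polynomial F) K

/-- Denominator of the left encoding. -/
noncomputable def leftDenom (x : F × F × F) : F[X] := 1 + X ^ 3 * C x.2.1

/-- Numerator of the first coordinate of the left encoding. -/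
noncomputable def leftNum (x : F × F × F) : F[X] := C x.1 + X * C x.2.1 + X ^ 2 * C x.2.2

/-- Denominator of the right encoding. -/
noncomputable def rightDenom (x : F × F × F) : F[X] := 1 + X ^ 2 * C x.2.1

/-- Numerator of the first coordinate of the right encoding. -/
noncomputable def rightNum (x : F × F × F) : F[X] := C x.1 + X * C x.2.1 + X ^ 3 * C x.2.2

theorem leftDenom_ne_zero (x : F × F × F) : leftDenom x ≠ 0 := by
  intro h
  have := coeff_eq_zero_of_cubic_add (a := 1) (b := 0) (c := 0) (d := x.2.1) (f := 0)
    (by simp only [map_one, map_zero]; simp only [leftDenom] at h; linear_combination h)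
  exact one_ne_zero this.1

theorem rightDenom_ne_zero (x : F × F × F) : rightDenom x ≠ 0 := by
  intro h
  have := coeff_eq_zero_of_cubic_add (a := 1) (b := 0) (c := x.2.1) (d := 0) (f := 0)
    (by simp only [map_one, map_zero]; simp only [rightDenom] at h; linear_combination h)
  exact one_ne_zero this.1

/-- A line in space over `F(T)` encoding a triple over `F`. -/
noncomputable def leftLine (x : F × F × F) :
    K × K × K :=
  (ι (leftNum x) / ι (leftDenom x), ι (C x.2.1) / ι (leftDenom x), ι (C x.2.2) / ι (leftDenom x))

/-- A line of the opposite kind in space over `F(T)` encoding a triple over `F`. -/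
noncomputable def rightLine (x : F × F × F) :
    K × K × K :=
  (ι (rightNum x) / ι (rightDenom x), ι (C x.2.1) / ι (rightDenom x),
    ι (C x.2.2) / ι (rightDenom x))

variable [IsFractionRing F[X] K]

theorem algebraMap_fraction_ne_zero {f : F[X]} (h : f ≠ 0) : ι f ≠ 0 :=
  fun e => h (IsFractionRing.injective F[X] K (e.trans (map_zero _).symm))

theorem leftLine_fst_injective :
    Function.Injective fun x : F × F × F => (leftLine x : K × K × K).1 := by
  intro x y h
  simp only [leftLine] at h
  rw [div_eq_div_iff (algebraMap_fraction_ne_zero (leftDenom_ne_zero x))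
    (algebraMap_fraction_ne_zero (leftDenom_ne_zero y)), ← map_mul, ← map_mul] at h
  replace h := IsFractionRing.injective F[X] K h
  obtain ⟨h0, h1, h2, -⟩ := coeff_eq_zero_of_cubic_add (a := x.1 - y.1) (b := x.2.1 - y.2.1)
    (c := x.2.2 - y.2.2) (d := x.1 * y.2.1 - y.1 * x.2.1)
    (f := X * C (x.2.2 * y.2.1 - y.2.2 * x.2.1)) (by
      simp only [leftNum, leftDenom] at h
      simp only [map_sub, map_mul]
      linear_combination h)
  exact Prod.ext (sub_eq_zero.1 h0) (Prod.ext (sub_eq_zero.1 h1) (sub_eq_zero.1 h2))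

theorem rightLine_fst_injective :
    Function.Injective fun x : F × F × F => (rightLine x : K × K × K).1 := by
  intro x y h
  simp only [rightLine] at h
  rw [div_eq_div_iff (algebraMap_fraction_ne_zero (rightDenom_ne_zero x))
    (algebraMap_fraction_ne_zero (rightDenom_ne_zero y)), ← map_mul, ← map_mul] at h
  replace h := IsFractionRing.injective F[X] K h
  obtain ⟨h0, h1, -, h2⟩ := coeff_eq_zero_of_cubic_add (a := x.1 - y.1) (b := x.2.1 - y.2.1)
    (c := x.1 * y.2.1 - y.1 * x.2.1) (d := x.2.2 - y.2.2)
    (f := X * C (x.2.2 * y.2.1 - y.2.2 * x.2.1)) (by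
      simp only [rightNum, rightDenom] at h
      simp only [map_sub, map_mul]
      linear_combination h)
  exact Prod.ext (sub_eq_zero.1 h0) (Prod.ext (sub_eq_zero.1 h1) (sub_eq_zero.1 h2))

theorem linesMeet_leftLine_rightLine {x y : F × F × F}
    (h : y.2.1 * x.1 + y.2.2 = x.2.1 * y.1 + x.2.2) :
    LinesMeet (leftLine x : K × K × K) (rightLine y) := by
  have hx := algebraMap_fraction_ne_zero (K := K) (leftDenom_ne_zero x)
  have hy := algebraMap_fraction_ne_zero (K := K) (rightDenom_ne_zero y)
  have key : C y.2.1 * leftNum x + C y.2.2 * leftDenom x =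
      C x.2.1 * rightNum y + C x.2.2 * rightDenom y := by
    replace h := congrArg (C : F → F[X]) h
    simp only [map_add, map_mul] at h
    simp only [leftNum, leftDenom, rightNum, rightDenom]
    linear_combination h
  replace key := congrArg ι key
  simp only [map_mul, map_add] at key
  simp only [LinesMeet, leftLine, rightLine]
  generalize ι (leftDenom x) = u at *
  generalize ι (rightDenom y) = w at *
  field_simp
  linear_combination key

/-- Three left lines on a common quadric come from three triples whose projections are
collinear. -/
theorem collinear_of_leftLine_quadric {x : Fin 3 → F × F × F}
    {α β γ δ : K}
    (h1 : ∀ i, (leftLine (x i)).2.1 = α * (leftLine (x i)).1 + γ)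
    (h2 : ∀ i, (leftLine (x i)).2.2 = β * (leftLine (x i)).1 + δ) (h : (x 0).1 = (x 1).1)
    (h' : x 0 ≠ x 1) : (x 2).1 = (x 0).1 := by
  have e1 : ∀ i, ι (C (x i).2.1) = α * ι (leftNum (x i)) + γ * ι (leftDenom (x i)) := fun i => by
    have := algebraMap_fraction_ne_zero (K := K) (leftDenom_ne_zero (x i))
    have e := h1 i
    simp only [leftLine] at e
    field_simp at e
    linear_combination e
  have e2 : ∀ i, ι (C (x i).2.2) = β * ι (leftNum (x i)) + δ * ι (leftDenom (x i)) := fun i => by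
    have := algebraMap_fraction_ne_zero (K := K) (leftDenom_ne_zero (x i))
    have e := h2 i
    simp only [leftLine] at e
    field_simp at e
    linear_combination e
  have d1 : leftNum (x 0) * (leftDenom (x 1) * C (x 2).2.1 - leftDenom (x 2) * C (x 1).2.1)
      - leftNum (x 1) * (leftDenom (x 0) * C (x 2).2.1 - leftDenom (x 2) * C (x 0).2.1)
      + leftNum (x 2) * (leftDenom (x 0) * C (x 1).2.1 - leftDenom (x 1) * C (x 0).2.1) = 0 := by
    apply IsFractionRing.injective F[X] K
    simp only [map_add, map_sub, map_mul, e1, map_zero]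
    ring
  have d2 : leftNum (x 0) * (leftDenom (x 1) * C (x 2).2.2 - leftDenom (x 2) * C (x 1).2.2)
      - leftNum (x 1) * (leftDenom (x 0) * C (x 2).2.2 - leftDenom (x 2) * C (x 0).2.2)
      + leftNum (x 2) * (leftDenom (x 0) * C (x 1).2.2 - leftDenom (x 1) * C (x 0).2.2) = 0 := by
    apply IsFractionRing.injective F[X] K
    simp only [map_add, map_sub, map_mul, e2, map_zero]
    ring
  clear e1 e2 h1 h2
  generalize x 0 = y at *
  generalize x 1 = y' at *
  generalize x 2 = y'' at *
  obtain ⟨a, s, t⟩ := y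
  obtain ⟨a', s', t'⟩ := y'
  obtain ⟨a'', s'', t''⟩ := y''
  simp only [leftNum, leftDenom] at d1 d2 h ⊢
  subst h
  have k1 := (coeff_eq_zero_of_cubic_add (a := a * (s'' - s') - a * (s'' - s) + a'' * (s' - s))
    (b := 0) (c := t * (s'' - s') - t' * (s'' - s) + t'' * (s' - s)) (d := 0) (f := 0) (by
      simp only [map_add, map_sub, map_mul, map_zero]
      linear_combination d1)).1
  have k2 := (coeff_eq_zero_of_cubic_add (a := a * (t'' - t') - a * (t'' - t) + a'' * (t' - t))
    (b := s * (t'' - t') - s' * (t'' - t) + s'' * (t' - t)) (c := 0)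
    (d := a * (s' * t'' - s'' * t') - a * (s * t'' - s'' * t) + a'' * (s * t' - s' * t))
    (f := 0) (by
      simp only [map_add, map_sub, map_mul, map_zero]
      linear_combination d2)).1
  by_contra hne
  have hne' := sub_ne_zero.2 hne
  apply h'
  have k3 : (a'' - a) * (s' - s) = 0 := by linear_combination k1
  have k4 : (a'' - a) * (t' - t) = 0 := by linear_combination k2
  have k5 := (mul_eq_zero.1 k3).resolve_left hne'
  have k6 := (mul_eq_zero.1 k4).resolve_left hne'
  rw [sub_eq_zero.1 k5, sub_eq_zero.1 k6]

/-- The relation between encoded triples: both swapped triples lie in `J`, with equal values. -/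
def SwapRel (J : Finset (F × F × F)) (x y : F × F × F) : Prop :=
  (x.1, y.2) ∈ J ∧ (y.1, x.2) ∈ J ∧ y.2.1 * x.1 + y.2.2 = x.2.1 * y.1 + x.2.2

theorem quadricBound_swapRel {A : Finset F} {Λ : Finset (F × F)} {J : Finset (F × F × F)} {k : ℕ}
    (hA : A.card ≤ k)
    (hk : ∀ u v, (J.filter fun j => j.1 = u ∧ j.2.1 * u + j.2.2 = v).card ≤ k) :
    QuadricBound (fun l r : K × K × K => ∃ x y, leftLine x = l ∧ rightLine y = r ∧ SwapRel J x y) k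
      ((A ×ˢ Λ).image leftLine) ((A ×ˢ Λ).image rightLine) := by
  intro α β γ δ r hr _ _
  obtain ⟨y, hy, rfl⟩ := Finset.mem_image.1 hr
  let Q := (A ×ˢ Λ).filter fun x => SwapRel J x y ∧
    (leftLine x : K × K × K).2.1 = α * (leftLine x : K × K × K).1 + γ ∧
    (leftLine x : K × K × K).2.2 = β * (leftLine x : K × K × K).1 + δ
  have hQ : ∀ x ∈ Q, x ∈ A ×ˢ Λ ∧ SwapRel J x y ∧
    (leftLine x : K × K × K).2.1 = α * (leftLine x : K × K × K).1 + γ ∧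
    (leftLine x : K × K × K).2.2 = β * (leftLine x : K × K × K).1 + δ := fun x hx =>
      Finset.mem_filter.1 hx
  have hsub : (((A ×ˢ Λ).image leftLine).filter fun l : K × K × K =>
      (∃ x z, leftLine x = l ∧ rightLine z = (rightLine y : K × K × K) ∧ SwapRel J x z) ∧
        l.2.1 = α * l.1 + γ ∧ l.2.2 = β * l.1 + δ) ⊆ Q.image leftLine := by
    intro l hl
    obtain ⟨hl, ⟨x, z, rfl, hz, hR⟩, h1, h2⟩ := Finset.mem_filter.1 hl
    obtain ⟨x', hx', hxx⟩ := Finset.mem_image.1 hl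
    obtain rfl : x' = x := leftLine_fst_injective (K := K) (congrArg Prod.fst hxx)
    obtain rfl : z = y := rightLine_fst_injective (K := K) (congrArg Prod.fst hz)
    exact Finset.mem_image_of_mem _ (Finset.mem_filter.2 ⟨hx', hR, h1, h2⟩)
  refine (Finset.card_le_card hsub).trans (Finset.card_image_le.trans ?_)
  by_cases hc : ∃ x ∈ Q, ∃ x' ∈ Q, x.1 = x'.1 ∧ x ≠ x'
  · obtain ⟨x, hx, x', hx', h1, h2⟩ := hc
    have hfst : ∀ z ∈ Q, z.1 = x.1 := fun z hz => by
      refine collinear_of_leftLine_quadric (x := ![x, x', z]) (α := α) (β := β) (γ := γ)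
        (δ := δ) ?_ ?_ h1 h2
      · intro i
        fin_cases i
        exacts [(hQ _ hx).2.2.1, (hQ _ hx').2.2.1, (hQ _ hz).2.2.1]
      · intro i
        fin_cases i
        exacts [(hQ _ hx).2.2.2, (hQ _ hx').2.2.2, (hQ _ hz).2.2.2]
    refine le_trans (Finset.card_le_card_of_injOn (fun z => (y.1, z.2)) ?_ ?_)
      (hk y.1 (y.2.1 * x.1 + y.2.2))
    · intro z hz
      have := (hQ z hz).2.1
      refine Finset.mem_coe.2 (Finset.mem_filter.2 ⟨this.2.1, rfl, ?_⟩)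
      rw [← hfst z hz]
      exact this.2.2.symm
    · intro z hz z' hz' he
      exact Prod.ext ((hfst z hz).trans (hfst z' hz').symm) (Prod.ext_iff.1 he).2
  · push Not at hc
    refine le_trans (Finset.card_le_card_of_injOn Prod.fst ?_ ?_) hA
    · intro z hz
      exact (Finset.mem_product.1 (hQ z hz).1).1
    · intro z hz z' hz' he
      exact hc z hz z' hz' he

theorem edgeCount_image {α β α' β' : Type*} [DecidableEq α'] [DecidableEq β']
    {f : α → α'} {g : β → β'} (hf : Function.Injective f)
    (hg : Function.Injective g) (H : α → β → Prop) (L : Finset α) (R : Finset β) :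
    edgeCount (fun a b => ∃ x y, f x = a ∧ g y = b ∧ H x y) (L.image f) (R.image g) =
      edgeCount H L R := by
  unfold edgeCount
  rw [Finset.sum_image hg.injOn]
  refine Finset.sum_congr rfl fun r _ => ?_
  rw [Finset.filter_image, Finset.card_image_of_injective _ hf]
  congr 1
  refine Finset.filter_congr fun l _ => ⟨?_, fun h => ⟨l, r, rfl, rfl, h⟩⟩
  rintro ⟨x, y, hx, hy, h⟩
  rwa [← hf hx, ← hg hy]

theorem edgeCount_swapRel_le_aux (K : Type*) [Field K] [Algebra F[X] K]
    [IsFractionRing F[X] K] {A : Finset F} {Λ : Finset (F × F)} {J : Finset (F × F × F)}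
    {k n : ℕ} (hA : A.card ≤ k)
    (hk : ∀ u v, (J.filter fun j => j.1 = u ∧ j.2.1 * u + j.2.2 = v).card ≤ k)
    (hchar : ∀ i : ℕ, i ≠ 0 → i ≤ n → (i : F) ≠ 0) (hn : A.card * Λ.card ≤ n ^ 2) :
    edgeCount (SwapRel J) (A ×ˢ Λ) (A ×ˢ Λ) ≤ 252 * 93312 * n ^ 3 + k * n ^ 2 := by
  have hl : Function.Injective (leftLine : F × F × F → K × K × K) := fun x y h =>
    leftLine_fst_injective (congrArg Prod.fst h)
  have hr : Function.Injective (rightLine : F × F × F → K × K × K) := fun x y h =>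
    rightLine_fst_injective (congrArg Prod.fst h)
  have : Infinite K := Infinite.of_injective _ (IsFractionRing.injective F[X] K)
  have hcl : ((A ×ˢ Λ).image (leftLine : F × F × F → K × K × K)).card ≤ n ^ 2 :=
    Finset.card_image_le.trans (by rwa [Finset.card_product])
  have hcr : ((A ×ˢ Λ).image (rightLine : F × F × F → K × K × K)).card ≤ n ^ 2 :=
    Finset.card_image_le.trans (by rwa [Finset.card_product])
  have key := edgeCount_lines_le (K := K)
    (G := fun l r : K × K × K => ∃ x y, leftLine x = l ∧ rightLine y = r ∧ SwapRel J x y)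
    (by
      rintro _ _ ⟨x, y, rfl, rfl, h⟩
      exact linesMeet_leftLine_rightLine h.2.2) (k := k) n
    (fun i hi hin h => hchar i hi hin (by
      apply C_injective
      apply IsFractionRing.injective F[X] K
      simpa using h))
    _ _ (quadricBound_swapRel hA hk)
    (by
      intro a ha b hb hab
      obtain ⟨x, -, rfl⟩ := Finset.mem_image.1 ha
      obtain ⟨y, -, rfl⟩ := Finset.mem_image.1 hb
      exact congrArg _ (leftLine_fst_injective (K := K) hab))
    (by
      intro a ha b hb hab
      obtain ⟨x, -, rfl⟩ := Finset.mem_image.1 ha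
      obtain ⟨y, -, rfl⟩ := Finset.mem_image.1 hb
      exact congrArg _ (rightLine_fst_injective (K := K) hab))
    hcl hcr
  rw [edgeCount_image hl hr] at key
  exact key.trans (Nat.add_le_add_left (Nat.mul_le_mul_left _ hcr) _)

theorem edgeCount_swapRel_le {A : Finset F} {Λ : Finset (F × F)} {J : Finset (F × F × F)}
    {k n : ℕ} (hA : A.card ≤ k)
    (hk : ∀ u v, (J.filter fun j => j.1 = u ∧ j.2.1 * u + j.2.2 = v).card ≤ k)
    (hchar : ∀ i : ℕ, i ≠ 0 → i ≤ n → (i : F) ≠ 0) (hn : A.card * Λ.card ≤ n ^ 2) :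
    edgeCount (SwapRel J) (A ×ˢ Λ) (A ×ˢ Λ) ≤ 252 * 93312 * n ^ 3 + k * n ^ 2 :=
  edgeCount_swapRel_le_aux (FractionRing F[X]) hA hk hchar hn

theorem sq_card_le_card_mul_card_pairs {α β : Type*} [DecidableEq β] (J : Finset α)
    (f : α → β) (B : Finset β)
    (hB : ∀ j ∈ J, f j ∈ B) :
    J.card ^ 2 ≤ B.card * ((J ×ˢ J).filter fun x => f x.1 = f x.2).card := by
  have h1 : J.card = ∑ b ∈ B, (J.filter fun j => f j = b).card :=
    Finset.card_eq_sum_card_fiberwise hB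
  have h2 : ((J ×ˢ J).filter fun x => f x.1 = f x.2).card =
      ∑ b ∈ B, (J.filter fun j => f j = b).card ^ 2 := by
    rw [Finset.card_eq_sum_card_fiberwise (f := fun x => f x.1) (t := B)]
    · refine Finset.sum_congr rfl fun b _ => ?_
      rw [sq, ← Finset.card_product]
      congr 1
      ext x
      simp only [Finset.mem_filter, Finset.mem_product]
      constructor
      · rintro ⟨⟨⟨h1, h2⟩, h3⟩, h4⟩
        exact ⟨⟨h1, h4⟩, h2, h3 ▸ h4⟩
      · rintro ⟨⟨h1, h4⟩, h2, h3⟩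
        exact ⟨⟨⟨h1, h2⟩, h4.trans h3.symm⟩, h4⟩
    · intro x hx
      exact hB _ (Finset.mem_product.1 (Finset.mem_filter.1 hx).1).1
  rw [h2]
  calc J.card ^ 2 = (∑ b ∈ B, 1 * (J.filter fun j => f j = b).card) ^ 2 := by simp [← h1]
    _ ≤ (∑ b ∈ B, 1 ^ 2) * ∑ b ∈ B, (J.filter fun j => f j = b).card ^ 2 :=
      Finset.sum_mul_sq_le_sq_mul_sq _ _ _
    _ = _ := by simp

/-- Incidences between non-vertical lines and points of a Cartesian product. -/
theorem sq_card_incidences_le {A B : Finset F} {Λ : Finset (F × F)} {J : Finset (F × F × F)}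
    {k n : ℕ} (hJ : J ⊆ A ×ˢ Λ) (hB : ∀ j ∈ J, j.2.1 * j.1 + j.2.2 ∈ B) (hA : A.card ≤ k)
    (hk : ∀ u v, (J.filter fun j => j.1 = u ∧ j.2.1 * u + j.2.2 = v).card ≤ k)
    (hchar : ∀ i : ℕ, i ≠ 0 → i ≤ n → (i : F) ≠ 0) (hn : A.card * Λ.card ≤ n ^ 2) :
    J.card ^ 2 ≤ B.card * (252 * 93312 * n ^ 3 + k * n ^ 2) := by
  refine (sq_card_le_card_mul_card_pairs J (fun j => j.2.1 * j.1 + j.2.2) B hB).trans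
    (Nat.mul_le_mul_left _ (le_trans ?_ (edgeCount_swapRel_le hA hk hchar hn)))
  have e : edgeCount (SwapRel J) (A ×ˢ Λ) (A ×ˢ Λ) =
      (((A ×ˢ Λ) ×ˢ (A ×ˢ Λ)).filter fun x => SwapRel J x.1 x.2).card := by
    rw [edgeCount_eq_sum_left, Finset.card_filter, Finset.sum_product (A ×ˢ Λ)]
    simp only [Finset.card_filter]
  rw [e]
  refine Finset.card_le_card_of_injOn
    (fun x : (F × F × F) × F × F × F => ((x.1.1, x.2.2), (x.2.1, x.1.2))) ?_ ?_
  · rintro ⟨x, y⟩ hx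
    obtain ⟨hxy, hv⟩ := Finset.mem_filter.1 hx
    obtain ⟨h1, h2⟩ := Finset.mem_product.1 hxy
    have h3 := Finset.mem_product.1 (hJ h1)
    have h4 := Finset.mem_product.1 (hJ h2)
    exact Finset.mem_coe.2 (Finset.mem_filter.2 ⟨Finset.mem_product.2
      ⟨Finset.mem_product.2 ⟨h3.1, h4.2⟩, Finset.mem_product.2 ⟨h4.1, h3.2⟩⟩, h1, h2, hv⟩)
  · rintro ⟨⟨a, b⟩, c, d⟩ _ ⟨⟨a', b'⟩, c', d'⟩ _ h
    simp only [Prod.mk.injEq] at h ⊢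
    tauto

end CartesianIncidences

section PlaneIncidences

variable {F : Type*} [Field F]

/-- The point `x` lies on the line `w.1 * X + w.2 * Y = 1`. -/
def Incident (x w : F × F) : Prop := x.1 * w.1 + x.2 * w.2 = 1

theorem eq_of_incident {x y w w' : F × F} (h1 : Incident x w) (h2 : Incident y w)
    (h3 : Incident x w') (h4 : Incident y w') (hxy : x ≠ y) : w = w' := by
  obtain ⟨a, b⟩ := x
  obtain ⟨c, d⟩ := y
  obtain ⟨s, t⟩ := w
  obtain ⟨s', t'⟩ := w'
  simp only [Incident] at h1 h2 h3 h4
  have hdet : a * d - b * c ≠ 0 := by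
    intro h
    have e1 : a = c := by linear_combination a * (-h2) + c * h1 + t * h
    have e2 : b = d := by linear_combination b * (-h2) + d * h1 - s * h
    exact hxy (by rw [e1, e2])
  have e1 : (a * d - b * c) * (s - s') = 0 := by
    linear_combination d * (h1 - h3) - b * (h2 - h4)
  have e2 : (a * d - b * c) * (t - t') = 0 := by
    linear_combination a * (h2 - h4) - c * (h1 - h3)
  rw [sub_eq_zero.1 ((mul_eq_zero.1 e1).resolve_left hdet),
    sub_eq_zero.1 ((mul_eq_zero.1 e2).resolve_left hdet)]

/-- The signed area vanishing exactly when `x` lies on the line through `p` and `q`. -/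
def signedArea (p q x : F × F) : F :=
  (q.1 - p.1) * (x.2 - p.2) - (q.2 - p.2) * (x.1 - p.1)

theorem signedArea_eq_zero {p q x w : F × F} (hx : Incident x w) (hp : Incident p w)
    (hq : Incident q w) : signedArea p q x = 0 := by
  obtain ⟨x, y⟩ := x
  obtain ⟨q1, q2⟩ := q
  obtain ⟨p1, p2⟩ := p
  obtain ⟨w, z⟩ := w
  simp only [Incident, signedArea] at *
  linear_combination (-((q1 - p1) * (y - p2) - (q2 - p2) * (x - p1))) * hx +
    x * ((y - p2) * (hq - hp) - (q2 - p2) * (hx - hp)) +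
    y * ((q1 - p1) * (hx - hp) - (x - p1) * (hq - hp))

theorem signedArea_ne_zero {p q x w : F × F} (hx : Incident x w) (hq : Incident q w)
    (hp : ¬ Incident p w) (hxq : x ≠ q) : signedArea p q x ≠ 0 := by
  obtain ⟨a, b⟩ := x
  obtain ⟨c, d⟩ := q
  obtain ⟨e, f⟩ := p
  obtain ⟨s, t⟩ := w
  simp only [Incident, signedArea] at *
  intro h
  have e1 : (a - c) * (e * s + f * t - 1) = 0 := by
    linear_combination t * h + (a - e) * hq  - (c - e) * hx
  have e2 : (b - d) * (e * s + f * t - 1) = 0 := by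
    linear_combination (-s) * h + (b - f) * hq  - (d - f) * hx
  have hne : e * s + f * t - 1 ≠ 0 := sub_ne_zero.2 hp
  apply hxq
  rw [sub_eq_zero.1 ((mul_eq_zero.1 e1).resolve_right hne),
    sub_eq_zero.1 ((mul_eq_zero.1 e2).resolve_right hne)]

/-- Projective coordinates sending two given points to infinity. -/
theorem exists_coordinates {p q : F × F} (hpq : p ≠ q) : ∃ u v s t a b : F × F → F,
    (∀ x w, signedArea p q x ≠ 0 → Incident x w → ¬ Incident p w → s w * u x + t w = v x) ∧
    (∀ x w, signedArea p q x ≠ 0 → Incident x w → Incident p w → u x = a w) ∧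
    (∀ x w, signedArea p q x ≠ 0 → Incident x w → Incident q w → v x = b w) ∧
    (∀ x y, signedArea p q x ≠ 0 → signedArea p q y ≠ 0 → u x = u y → v x = v y → x = y) ∧
    ∀ w w', ¬ Incident p w → ¬ Incident p w' → s w = s w' → t w = t w' → w = w' := by
  obtain ⟨α, β, hφ⟩ : ∃ α β : F, α * (q.1 - p.1) + β * (q.2 - p.2) ≠ 0 := by
    by_contra! hc
    have h1 := hc 1 0
    have h2 := hc 0 1
    apply hpq
    ext
    · linear_combination -h1
    · linear_combination -h2
  obtain ⟨p1, p2⟩ := p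
  obtain ⟨q1, q2⟩ := q
  refine ⟨fun z => (α * (z.1 - p1) + β * (z.2 - p2)) / signedArea (p1, p2) (q1, q2) z,
    fun z => (α * (z.1 - q1) + β * (z.2 - q2)) / signedArea (p1, p2) (q1, q2) z,
    fun w => (1 - q1 * w.1 - q2 * w.2) / (1 - p1 * w.1 - p2 * w.2),
    fun w => (β * w.1 - α * w.2) / (1 - p1 * w.1 - p2 * w.2),
    fun w => (β * w.1 - α * w.2) / (q1 * w.1 + q2 * w.2 - 1),
    fun w => (β * w.1 - α * w.2) / (1 - p1 * w.1 - p2 * w.2), ?_, ?_, ?_, ?_, ?_⟩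
  · rintro ⟨x, y⟩ ⟨w, z⟩ h0 h1 h2
    simp only [Incident, signedArea] at *
    have hκ : 1 - p1 * w - p2 * z ≠ 0 := fun h => h2 (by linear_combination -h)
    generalize hd : (q1 - p1) * (y - p2) - (q2 - p2) * (x - p1) = d at *
    generalize hk : 1 - p1 * w - p2 * z = κ at *
    field_simp
    subst hd hk
    linear_combination (-(α * (q1 - p1) + β * (q2 - p2))) * h1
  · rintro ⟨x, y⟩ ⟨w, z⟩ h0 h1 h2
    have hκ : q1 * w + q2 * z - 1 ≠ 0 := fun h =>
      h0 (signedArea_eq_zero h1 h2 (sub_eq_zero.1 h))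
    simp only [Incident, signedArea] at *
    rw [div_eq_div_iff h0 hκ]
    linear_combination (α * (q1 - p1) + β * (q2 - p2)) * (h1 - h2) +
      (α * (x - p1) + β * (y - p2)) * h2
  · rintro ⟨x, y⟩ ⟨w, z⟩ h0 h1 h2
    have hκ : 1 - p1 * w - p2 * z ≠ 0 := fun h =>
      h0 (signedArea_eq_zero h1 (by simp only [Incident]; linear_combination -h) h2)
    simp only [Incident, signedArea] at *
    rw [div_eq_div_iff h0 hκ]
    linear_combination (α * (q1 - p1) + β * (q2 - p2)) * (h1 - h2) -
      (α * (x - q1) + β * (y - q2)) * h2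
  · rintro ⟨x, y⟩ ⟨x', y'⟩ h0 h0' h1 h2
    simp only [signedArea] at *
    rw [div_eq_div_iff h0 h0'] at h1 h2
    have hd := mul_left_cancel₀ hφ (a := α * (q1 - p1) + β * (q2 - p2))
      (b := (q1 - p1) * (y - p2) - (q2 - p2) * (x - p1))
      (c := (q1 - p1) * (y' - p2) - (q2 - p2) * (x' - p1)) (by linear_combination h2 - h1)
    rw [hd] at h1
    have h3 := mul_right_cancel₀ h0' h1
    have e1 := mul_left_cancel₀ hφ (b := x) (c := x')
      (by linear_combination (q1 - p1) * h3 - β * hd)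
    have e2 := mul_left_cancel₀ hφ (b := y) (c := y')
      (by linear_combination (q2 - p2) * h3 + α * hd)
    rw [e1, e2]
  · rintro ⟨w, z⟩ ⟨w', z'⟩ h h' h1 h2
    simp only [Incident] at *
    have hκ : 1 - p1 * w - p2 * z ≠ 0 := fun e => h (by linear_combination -e)
    have hκ' : 1 - p1 * w' - p2 * z' ≠ 0 := fun e => h' (by linear_combination -e)
    rw [div_eq_div_iff hκ hκ'] at h1 h2
    have e1 := mul_left_cancel₀ hφ (b := (1 - p1 * w' - p2 * z') * w)
      (c := (1 - p1 * w - p2 * z) * w') (by linear_combination (-α) * h1 + (q2 - p2) * h2)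
    have e2 := mul_left_cancel₀ hφ (b := (1 - p1 * w' - p2 * z') * z)
      (c := (1 - p1 * w - p2 * z) * z') (by linear_combination (-β) * h1 - (q1 - p1) * h2)
    have e3 : 1 - p1 * w' - p2 * z' = 1 - p1 * w - p2 * z := by
      linear_combination p1 * e1 + p2 * e2
    rw [e3] at e1 e2
    rw [mul_left_cancel₀ hκ e1, mul_left_cancel₀ hκ e2]

end PlaneIncidences

section PinnedPencils

variable {F : Type*} [Field F]

theorem card_not_incident {G : Finset ((F × F) × F × F)} (hG : ∀ f ∈ G, Incident f.1 f.2)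
    {p x : F × F} (hxp : x ≠ p) {h : ℕ} (hx : h < (G.filter fun f => f.1 = x).card) :
    h ≤ (G.filter fun f => f.1 = x ∧ ¬ Incident p f.2).card := by
  have h1 : (G.filter fun f => f.1 = x ∧ Incident p f.2).card ≤ 1 := by
    refine Finset.card_le_one.2 fun f hf f' hf' => ?_
    obtain ⟨h1, h2, h3⟩ := Finset.mem_filter.1 hf
    obtain ⟨h1', h2', h3'⟩ := Finset.mem_filter.1 hf'
    exact Prod.ext (h2.trans h2'.symm)
      (eq_of_incident (h2 ▸ hG _ h1) h3 (h2' ▸ hG _ h1') h3' hxp)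
  have h2 := Finset.card_filter_add_card_filter_not (s := G.filter fun f => f.1 = x)
    fun f => Incident p f.2
  rw [Finset.filter_filter, Finset.filter_filter] at h2
  lia

/-- The incidences on the points joined to `q` that lie on few lines through `p`. -/
theorem sq_card_joined_le {G : Finset ((F × F) × F × F)} (hG : ∀ f ∈ G, Incident f.1 f.2)
    {p q : F × F} {W : Finset (F × F)} (hW : ∀ w ∈ W, Incident p w) {X : Finset (F × F)}
    (hXq : ∀ x ∈ X, x ≠ q) (hXW : ∀ x ∈ X, ∃ w ∈ W, Incident x w)
    (hXG : ∀ x ∈ X, ∃ w, (x, w) ∈ G ∧ (q, w) ∈ G ∧ ¬ Incident p w) {h n m : ℕ}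
    (hWh : W.card ≤ h) (hhn : h ≤ n) (hmn : h * m ≤ n ^ 2) (hGm : (G.image Prod.snd).card ≤ m)
    (hdeg : ∀ x ∈ X, (G.filter fun f => f.1 = x).card ≤ n)
    (hmin : ∀ x ∈ X, h < (G.filter fun f => f.1 = x).card)
    (hchar : ∀ i : ℕ, i ≠ 0 → i ≤ n → (i : F) ≠ 0) :
    (h * X.card) ^ 2 ≤
      (G.filter fun f => f.1 = q).card * (252 * 93312 * n ^ 3 + n * n ^ 2) := by
  rcases X.eq_empty_or_nonempty with rfl | ⟨x₀, hx₀⟩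
  · simp
  have hpq : p ≠ q := by
    rintro rfl
    obtain ⟨w, -, h1, h2⟩ := hXG x₀ hx₀
    exact h2 (hG _ h1)
  have harea : ∀ x ∈ X, signedArea p q x ≠ 0 := fun x hx => by
    obtain ⟨w, h1, h2, h3⟩ := hXG x hx
    exact signedArea_ne_zero (hG _ h1) (hG _ h2) h3 (hXq x hx)
  obtain ⟨u, v, s, t, a, b, hst, ha, hb, huv, hinj⟩ := exists_coordinates hpq
  let J₀ := G.filter fun f => f.1 ∈ X ∧ ¬ Incident p f.2
  have hJ₀ : ∀ f ∈ J₀, f ∈ G ∧ f.1 ∈ X ∧ ¬ Incident p f.2 := fun f hf => Finset.mem_filter.1 hf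
  have hlow : h * X.card ≤ J₀.card := by
    rw [Finset.card_eq_sum_card_fiberwise (f := Prod.fst) (t := X) fun f hf => (hJ₀ f hf).2.1,
      mul_comm]
    refine Finset.card_nsmul_le_sum _ _ _ fun x hx => ?_
    have hxp : x ≠ p := by
      rintro rfl
      obtain ⟨w, h1, -, h2⟩ := hXG x hx
      exact h2 (hG _ h1)
    refine (card_not_incident hG hxp (hmin x hx)).trans (Finset.card_le_card fun f hf => ?_)
    obtain ⟨h1, h2, h3⟩ := Finset.mem_filter.1 hf
    exact Finset.mem_filter.2 ⟨Finset.mem_filter.2 ⟨h1, h2 ▸ hx, h3⟩, h2⟩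
  let ψ : (F × F) × F × F → F × F × F := fun f => (u f.1, s f.2, t f.2)
  have hval : ∀ f ∈ J₀, s f.2 * u f.1 + t f.2 = v f.1 := fun f hf =>
    hst _ _ (harea _ (hJ₀ f hf).2.1) (hG _ (hJ₀ f hf).1) (hJ₀ f hf).2.2
  have hfst : ∀ f ∈ J₀, ∀ f' ∈ J₀, u f.1 = u f'.1 → v f.1 = v f'.1 → f.1 = f'.1 :=
    fun f hf f' hf' => huv _ _ (harea _ (hJ₀ f hf).2.1) (harea _ (hJ₀ f' hf').2.1)
  have hψ : Set.InjOn ψ J₀ := by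
    intro f hf f' hf' e
    simp only [ψ, Prod.mk.injEq] at e
    refine Prod.ext (hfst f hf f' hf' e.1 ?_) (hinj _ _ (hJ₀ f hf).2.2 (hJ₀ f' hf').2.2 e.2.1 e.2.2)
    rw [← hval f hf, ← hval f' hf', e.1, e.2.1, e.2.2]
  have key := sq_card_incidences_le (A := W.image a)
    (B := (G.filter fun f => f.1 = q).image fun f => b f.2)
    (Λ := (G.image Prod.snd).image fun w => (s w, t w)) (J := J₀.image ψ) (k := n) (n := n)
    ?_ ?_ ?_ ?_ hchar ?_
  · rw [Finset.card_image_of_injOn hψ] at key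
    exact (Nat.pow_le_pow_left hlow 2).trans
      (key.trans (Nat.mul_le_mul_right _ Finset.card_image_le))
  · intro j hj
    obtain ⟨f, hf, rfl⟩ := Finset.mem_image.1 hj
    obtain ⟨h1, h2, h3⟩ := hJ₀ f hf
    obtain ⟨w, hw, h4⟩ := hXW _ h2
    refine Finset.mem_product.2
      ⟨Finset.mem_image.2 ⟨w, hw, (ha _ _ (harea _ h2) h4 (hW _ hw)).symm⟩,
      Finset.mem_image_of_mem _ (Finset.mem_image_of_mem _ h1)⟩
  · intro j hj
    obtain ⟨f, hf, rfl⟩ := Finset.mem_image.1 hj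
    obtain ⟨h1, h2, h3⟩ := hJ₀ f hf
    obtain ⟨w, h4, h5, -⟩ := hXG _ h2
    refine Finset.mem_image.2 ⟨(q, w), Finset.mem_filter.2 ⟨h5, rfl⟩, ?_⟩
    exact ((hval f hf).trans (hb f.1 w (harea _ h2) (hG _ h4) (hG _ h5))).symm
  · exact (Finset.card_image_le.trans hWh).trans hhn
  · intro u₀ v₀
    rcases Finset.eq_empty_or_nonempty
      ((J₀.image ψ).filter fun j => j.1 = u₀ ∧ j.2.1 * u₀ + j.2.2 = v₀) with he | ⟨j, hj⟩
    · rw [he]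
      exact Nat.zero_le _
    obtain ⟨hj', rfl, rfl⟩ := Finset.mem_filter.1 hj
    obtain ⟨f, hf, rfl⟩ := Finset.mem_image.1 hj'
    refine le_trans (Finset.card_le_card (t := (G.filter fun f' => f'.1 = f.1).image ψ) ?_)
      (Finset.card_image_le.trans (hdeg _ (hJ₀ f hf).2.1))
    intro j hj'
    obtain ⟨hj', h1, h2⟩ := Finset.mem_filter.1 hj'
    obtain ⟨f', hf', rfl⟩ := Finset.mem_image.1 hj'
    refine Finset.mem_image_of_mem _ (Finset.mem_filter.2 ⟨(hJ₀ f' hf').1, ?_⟩)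
    refine hfst f' hf' f hf h1 ?_
    rw [← hval f hf, ← hval f' hf']
    simp only [ψ] at h1 h2
    rw [h1, h2]
  · exact (Nat.mul_le_mul (Finset.card_image_le.trans hWh)
      (Finset.card_image_le.trans hGm)).trans hmn

end PinnedPencils

section BalancedIncidences

theorem exists_large_degrees {α β : Type*} [DecidableEq α] [DecidableEq β] (h N : ℕ) :
    ∀ G : Finset (α × β), G.card = N →
    h * ((G.image Prod.fst).card + (G.image Prod.snd).card) < G.card →
    ∃ G' ⊆ G, G'.Nonempty ∧ (∀ f ∈ G', h < (G'.filter fun g => g.1 = f.1).card) ∧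
      ∀ f ∈ G', h < (G'.filter fun g => g.2 = f.2).card := by
  induction N using Nat.strong_induction_on with
  | _ N ih =>
  intro G hN hG
  by_cases h1 : ∃ f ∈ G, (G.filter fun g => g.1 = f.1).card ≤ h
  · obtain ⟨f, hf, hle⟩ := h1
    have hc := Finset.card_filter_add_card_filter_not (s := G) fun g => g.1 = f.1
    have hpos : 0 < (G.filter fun g => g.1 = f.1).card :=
      Finset.card_pos.2 ⟨f, Finset.mem_filter.2 ⟨hf, rfl⟩⟩
    have hfst : ((G.filter fun g => ¬ g.1 = f.1).image Prod.fst).card <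
        (G.image Prod.fst).card := by
      refine Finset.card_lt_card (Finset.ssubset_iff_subset_ne.2
        ⟨Finset.image_subset_image (Finset.filter_subset _ _), fun e => ?_⟩)
      obtain ⟨g, hg, he⟩ := Finset.mem_image.1 (e ▸ Finset.mem_image_of_mem Prod.fst hf)
      exact (Finset.mem_filter.1 hg).2 he
    have hsnd : ((G.filter fun g => ¬ g.1 = f.1).image Prod.snd).card ≤ (G.image Prod.snd).card :=
      Finset.card_le_card (Finset.image_subset_image (Finset.filter_subset _ _))
    obtain ⟨G', hG', h2⟩ := ih _ (by lia) (G.filter fun g => ¬ g.1 = f.1) rfl (by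
      have := Nat.mul_le_mul_left h (Nat.add_le_add hfst hsnd)
      have : h * (((G.filter fun g => ¬ g.1 = f.1).image Prod.fst).card + 1 +
        ((G.filter fun g => ¬ g.1 = f.1).image Prod.snd).card) =
        h * (((G.filter fun g => ¬ g.1 = f.1).image Prod.fst).card +
        ((G.filter fun g => ¬ g.1 = f.1).image Prod.snd).card) + h := by ring
      lia)
    exact ⟨G', hG'.trans (Finset.filter_subset _ _), h2⟩
  by_cases h2 : ∃ f ∈ G, (G.filter fun g => g.2 = f.2).card ≤ h
  · obtain ⟨f, hf, hle⟩ := h2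
    have hc := Finset.card_filter_add_card_filter_not (s := G) fun g => g.2 = f.2
    have hpos : 0 < (G.filter fun g => g.2 = f.2).card :=
      Finset.card_pos.2 ⟨f, Finset.mem_filter.2 ⟨hf, rfl⟩⟩
    have hsnd : ((G.filter fun g => ¬ g.2 = f.2).image Prod.snd).card <
        (G.image Prod.snd).card := by
      refine Finset.card_lt_card (Finset.ssubset_iff_subset_ne.2
        ⟨Finset.image_subset_image (Finset.filter_subset _ _), fun e => ?_⟩)
      obtain ⟨g, hg, he⟩ := Finset.mem_image.1 (e ▸ Finset.mem_image_of_mem Prod.snd hf)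
      exact (Finset.mem_filter.1 hg).2 he
    have hfst : ((G.filter fun g => ¬ g.2 = f.2).image Prod.fst).card ≤ (G.image Prod.fst).card :=
      Finset.card_le_card (Finset.image_subset_image (Finset.filter_subset _ _))
    obtain ⟨G', hG', h2⟩ := ih _ (by lia) (G.filter fun g => ¬ g.2 = f.2) rfl (by
      have := Nat.mul_le_mul_left h (Nat.add_le_add hfst hsnd)
      have : h * (((G.filter fun g => ¬ g.2 = f.2).image Prod.fst).card +
        (((G.filter fun g => ¬ g.2 = f.2).image Prod.snd).card + 1)) =
        h * (((G.filter fun g => ¬ g.2 = f.2).image Prod.fst).card +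
        ((G.filter fun g => ¬ g.2 = f.2).image Prod.snd).card) + h := by ring
      lia)
    exact ⟨G', hG'.trans (Finset.filter_subset _ _), h2⟩
  push Not at h1 h2
  exact ⟨G, Finset.Subset.refl _, Finset.card_pos.1 (by lia), h1, h2⟩

variable {F : Type*} [Field F]

theorem card_le_of_large_degrees {G : Finset ((F × F) × F × F)}
    (hG : ∀ f ∈ G, Incident f.1 f.2) {m n : ℕ} (hm : (G.image Prod.snd).card ≤ m)
    (hn : 2 * m ≤ n ^ 2) (hdeg : ∀ f ∈ G, n ≤ (G.filter fun g => g.1 = f.1).card) :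
    G.card ≤ 2 * m := by
  have h1 := sq_card_le_card_mul_card_pairs G Prod.snd (G.image Prod.snd)
    fun f hf => Finset.mem_image_of_mem _ hf
  have h2 : ((G ×ˢ G).filter fun x => x.1.2 = x.2.2).card ≤
      G.card + (G.image Prod.fst).card ^ 2 := by
    rw [← Finset.card_filter_add_card_filter_not fun x => x.1 = x.2]
    refine Nat.add_le_add ?_ ?_
    · refine Finset.card_le_card_of_injOn Prod.fst ?_ ?_
      · intro x hx
        exact (Finset.mem_product.1 (Finset.mem_filter.1 (Finset.mem_filter.1 hx).1).1).1
      · intro x hx y hy e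
        exact Prod.ext e ((Finset.mem_filter.1 hx).2.symm.trans
          (e.trans (Finset.mem_filter.1 hy).2))
    · rw [sq, ← Finset.card_product]
      refine Finset.card_le_card_of_injOn (fun x => (x.1.1, x.2.1)) ?_ ?_
      · intro x hx
        have := Finset.mem_product.1 (Finset.mem_filter.1 (Finset.mem_filter.1 hx).1).1
        exact Finset.mem_coe.2 (Finset.mem_product.2 ⟨Finset.mem_image.2 ⟨_, this.1, rfl⟩,
          Finset.mem_image.2 ⟨_, this.2, rfl⟩⟩)
      · rintro ⟨⟨x, w⟩, y, z⟩ hx ⟨⟨x', w'⟩, y', z'⟩ hy e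
        obtain ⟨hx, hne⟩ := Finset.mem_filter.1 hx
        obtain ⟨hx, h1⟩ := Finset.mem_filter.1 hx
        obtain ⟨hx, hy'⟩ := Finset.mem_product.1 hx
        obtain ⟨hy, -⟩ := Finset.mem_filter.1 hy
        obtain ⟨hy, h2⟩ := Finset.mem_filter.1 hy
        obtain ⟨hy, hy''⟩ := Finset.mem_product.1 hy
        simp only [Prod.mk.injEq] at e h1 h2
        obtain ⟨rfl, rfl⟩ := e
        subst h1 h2
        have hxy : x ≠ y := fun e => hne (by simp only [e])
        obtain rfl : w = w' :=
          eq_of_incident (hG (x, w) hx) (hG (y, w) hy') (hG (x, w') hy) (hG (y, w') hy'') hxy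
        rfl
  have h3 : n * (G.image Prod.fst).card ≤ G.card := by
    rw [Finset.card_eq_sum_card_image Prod.fst G, mul_comm]
    refine Finset.card_nsmul_le_sum _ _ _ fun x hx => ?_
    obtain ⟨f, hf, rfl⟩ := Finset.mem_image.1 hx
    exact hdeg f hf
  by_contra! hlt
  generalize G.card = e at *
  generalize (G.image Prod.fst).card = a at *
  have h4 : e ^ 2 ≤ m * (e + a ^ 2) := h1.trans (Nat.mul_le_mul hm h2)
  have h5 : (n * a) ^ 2 ≤ e ^ 2 := Nat.pow_le_pow_left h3 2
  have h6 : 2 * m * a ^ 2 ≤ n ^ 2 * a ^ 2 := Nat.mul_le_mul_right _ hn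
  nlinarith

/-- Lines through a common point carry many further points. -/
theorem mul_card_le_card_joined {G : Finset ((F × F) × F × F)} (hG : ∀ f ∈ G, Incident f.1 f.2)
    {h : ℕ} (hdeg : ∀ f ∈ G, h < (G.filter fun g => g.2 = f.2).card) {x : F × F}
    {V : Finset (F × F)} (hV : ∀ w ∈ V, (x, w) ∈ G) :
    h * V.card ≤
      ((G.image Prod.fst).filter fun y => y ≠ x ∧ ∃ w ∈ V, (y, w) ∈ G).card := by
  let T := G.filter fun f => f.2 ∈ V ∧ f.1 ≠ x
  have hT : h * V.card ≤ T.card := by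
    rw [Finset.card_eq_sum_card_fiberwise (f := Prod.snd) (t := V)
      fun f hf => (Finset.mem_filter.1 hf).2.1, mul_comm]
    refine Finset.card_nsmul_le_sum _ _ _ fun w hw => ?_
    have h1 : (G.filter fun f => f.2 = w).erase (x, w) ⊆ T.filter fun f => f.2 = w := by
      rintro ⟨y, z⟩ hf
      obtain ⟨h1, h2'⟩ := Finset.mem_erase.1 hf
      obtain ⟨h2, rfl⟩ := Finset.mem_filter.1 h2'
      refine Finset.mem_filter.2 ⟨Finset.mem_filter.2 ⟨h2, hw, ?_⟩, rfl⟩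
      rintro rfl
      exact h1 rfl
    have h2 := Finset.card_le_card h1
    have h3 := Finset.pred_card_le_card_erase (s := G.filter fun f => f.2 = w) (a := (x, w))
    have h4 := hdeg _ (hV w hw)
    simp only at h4
    lia
  refine hT.trans (Finset.card_le_card_of_injOn Prod.fst ?_ ?_)
  · intro f hf
    obtain ⟨h1, h2, h3⟩ := Finset.mem_filter.1 hf
    exact Finset.mem_coe.2 (Finset.mem_filter.2 ⟨Finset.mem_image_of_mem _ h1, h3, f.2, h2, h1⟩)
  · rintro ⟨y, w⟩ hf ⟨y', w'⟩ hf' e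
    obtain ⟨h1, h2, h3⟩ := Finset.mem_filter.1 hf
    obtain ⟨h1', h2', h3'⟩ := Finset.mem_filter.1 hf'
    simp only at e h2 h2' h3
    subst e
    obtain rfl : w = w' := eq_of_incident (hG (y, w) h1) (hG (x, w) (hV w h2)) (hG (y, w') h1')
      (hG (x, w') (hV w' h2')) h3
    rfl

/-- Counting pairs of points joined through pencils at two further points. -/
theorem pow_le_of_large_degrees {G : Finset ((F × F) × F × F)}
    (hG : ∀ f ∈ G, Incident f.1 f.2) (hne : G.Nonempty) {h n m e : ℕ} (he : G.card ≤ e)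
    (hhn : h ≤ n) (hmn : h * m ≤ n ^ 2)
    (hP : (G.image Prod.fst).card ≤ m) (hW : (G.image Prod.snd).card ≤ m)
    (hdeg : ∀ f ∈ G, (G.filter fun g => g.1 = f.1).card ≤ n)
    (h1 : ∀ f ∈ G, h < (G.filter fun g => g.1 = f.1).card)
    (h2 : ∀ f ∈ G, h < (G.filter fun g => g.2 = f.2).card)
    (hchar : ∀ i : ℕ, i ≠ 0 → i ≤ n → (i : F) ≠ 0) :
    (h * (h * h * (h * h))) ^ 2 ≤ m * (e * (252 * 93312 * n ^ 3 + n * n ^ 2)) := by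
  obtain ⟨⟨p, w₀⟩, hp⟩ := hne
  have hpW : h ≤ ((G.filter fun g => g.1 = p).image Prod.snd).card := by
    rw [Finset.card_image_of_injOn]
    · exact (h1 _ hp).le
    · intro f hf f' hf' e
      exact Prod.ext ((Finset.mem_filter.1 hf).2.trans (Finset.mem_filter.1 hf').2.symm) e
  obtain ⟨W, hWs, hWc⟩ := Finset.exists_subset_card_eq hpW
  have hWG : ∀ w ∈ W, (p, w) ∈ G := fun w hw => by
    obtain ⟨⟨y, w'⟩, hf, rfl⟩ := Finset.mem_image.1 (hWs hw)
    obtain ⟨hf', rfl⟩ := Finset.mem_filter.1 hf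
    exact hf'
  let X := (G.image Prod.fst).filter fun y => y ≠ p ∧ ∃ w ∈ W, (y, w) ∈ G
  have hX : h * h ≤ X.card := by
    have := mul_card_le_card_joined hG h2 hWG
    rwa [hWc] at this
  let Q := G.image Prod.fst
  let Y : F × F → Finset (F × F) := fun q => X.filter fun x => q ≠ x ∧
    ∃ w, (x, w) ∈ G ∧ (q, w) ∈ G ∧ ¬ Incident p w
  have hY : h * h * (h * h) ≤ ∑ q ∈ Q, (Y q).card := by
    refine le_trans ?_ (Finset.sum_card_bipartiteAbove_eq_sum_card_bipartiteBelow
      fun q x => q ≠ x ∧ ∃ w, (x, w) ∈ G ∧ (q, w) ∈ G ∧ ¬ Incident p w).ge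
    refine le_trans ?_ (Finset.card_nsmul_le_sum X _ (h * h) fun x hx => ?_)
    · exact Nat.mul_le_mul_right _ hX
    obtain ⟨hxQ, hxp, w₁, -, hx₁⟩ := Finset.mem_filter.1 hx
    let V := (G.filter fun f => f.1 = x ∧ ¬ Incident p f.2).image Prod.snd
    have hVm : ∀ w ∈ V, (x, w) ∈ G ∧ ¬ Incident p w := fun w hw => by
      obtain ⟨⟨y, w'⟩, hf, rfl⟩ := Finset.mem_image.1 hw
      obtain ⟨hf', rfl, h3⟩ := Finset.mem_filter.1 hf
      exact ⟨hf', h3⟩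
    have hV : h ≤ V.card := by
      rw [Finset.card_image_of_injOn]
      · exact card_not_incident hG hxp (h1 _ hx₁)
      · intro f hf f' hf' e
        exact Prod.ext ((Finset.mem_filter.1 hf).2.1.trans (Finset.mem_filter.1 hf').2.1.symm) e
    refine (Nat.mul_le_mul_left h hV).trans ((mul_card_le_card_joined hG h2
      fun w hw => (hVm w hw).1).trans (Finset.card_le_card fun q hq => ?_))
    obtain ⟨hq, hqx, w, hw, hqw⟩ := Finset.mem_filter.1 hq
    exact Finset.mem_filter.2 ⟨hq, hqx, w, (hVm w hw).1, hqw, (hVm w hw).2⟩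
  have hD : ∑ q ∈ Q, (G.filter fun f => f.1 = q).card = G.card :=
    (Finset.card_eq_sum_card_image Prod.fst G).symm
  have hq : ∀ q ∈ Q, (h * (Y q).card) ^ 2 ≤
      (G.filter fun f => f.1 = q).card * (252 * 93312 * n ^ 3 + n * n ^ 2) := fun q _ => by
    have hXG : ∀ x ∈ X, ∃ w, (x, w) ∈ G := fun x hx => by
      obtain ⟨f, hf, rfl⟩ := Finset.mem_image.1 (Finset.mem_filter.1 hx).1
      exact ⟨f.2, hf⟩
    refine sq_card_joined_le hG (W := W) (fun w hw => hG _ (hWG w hw))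
      (fun x hx => (Finset.mem_filter.1 hx).2.1.symm) (fun x hx => ?_)
      (fun x hx => (Finset.mem_filter.1 hx).2.2) hWc.le hhn hmn hW (fun x hx => ?_)
      (fun x hx => ?_) hchar
    · obtain ⟨-, -, w, h3, h4⟩ := Finset.mem_filter.1 (Finset.mem_filter.1 hx).1
      exact ⟨w, h3, hG _ h4⟩
    · obtain ⟨w, hw⟩ := hXG x (Finset.mem_filter.1 hx).1
      exact hdeg _ hw
    · obtain ⟨w, hw⟩ := hXG x (Finset.mem_filter.1 hx).1
      exact h1 _ hw
  calc (h * (h * h * (h * h))) ^ 2 ≤ (∑ q ∈ Q, 1 * (h * (Y q).card)) ^ 2 := by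
        refine Nat.pow_le_pow_left ?_ 2
        simp only [one_mul]
        rw [← Finset.mul_sum]
        exact Nat.mul_le_mul_left _ hY
    _ ≤ (∑ q ∈ Q, 1 ^ 2) * ∑ q ∈ Q, (h * (Y q).card) ^ 2 := Finset.sum_mul_sq_le_sq_mul_sq _ _ _
    _ ≤ m * (e * (252 * 93312 * n ^ 3 + n * n ^ 2)) := by
        refine Nat.mul_le_mul (by simpa using hP) ((Finset.sum_le_sum hq).trans ?_)
        rw [← Finset.sum_mul, hD]
        exact Nat.mul_le_mul_right _ he

/-- Incidences between at most `m` points and at most `m` lines of the plane. -/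
theorem card_incident_le {m h : ℕ} (hm : 576 * (252 * 93312 + 1) ^ 2 * m ^ 7 < h ^ 15)
    (h2 : 2 ≤ h) (hhm : h ≤ m) (hchar : ∀ i : ℕ, i ≠ 0 → i ^ 2 ≤ 4 * (h * m) → (i : F) ≠ 0)
    {G : Finset ((F × F) × F × F)} (hG : ∀ f ∈ G, Incident f.1 f.2)
    (hP : (G.image Prod.fst).card ≤ m) (hW : (G.image Prod.snd).card ≤ m) :
    G.card ≤ 4 * (h * m) := by
  have hhm1 : 2 * 2 ≤ h * m := Nat.mul_le_mul h2 (h2.trans hhm)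
  have hhm2 : 2 * m ≤ h * m := Nat.mul_le_mul_right _ h2
  have hhm3 : h * h ≤ h * m := Nat.mul_le_mul_left _ hhm
  obtain ⟨n, hn1, hn2⟩ : ∃ n, h * m ≤ n ^ 2 ∧ n ^ 2 ≤ 4 * (h * m) := by
    refine ⟨(h * m).sqrt + 1, (Nat.lt_succ_sqrt' _).le, ?_⟩
    have h3 := Nat.sqrt_le' (h * m)
    have h4 : 1 ≤ (h * m).sqrt := Nat.sqrt_pos.2 (by lia)
    nlinarith
  have hhn : h ≤ n := by nlinarith
  by_contra! hlt
  let H := G.filter fun f => n < (G.filter fun g => g.1 = f.1).card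
  have hH : H.card ≤ 2 * m := by
    refine card_le_of_large_degrees (n := n) (fun f hf => hG f (Finset.mem_filter.1 hf).1)
      ((Finset.card_le_card (Finset.image_subset_image (Finset.filter_subset _ _))).trans hW)
      (hhm2.trans hn1) fun f hf => ?_
    have h3 : (H.filter fun g => g.1 = f.1) = G.filter fun g => g.1 = f.1 := by
      ext g
      simp only [H, Finset.mem_filter] at hf ⊢
      constructor
      · rintro ⟨⟨h3, -⟩, h4⟩
        exact ⟨h3, h4⟩
      · rintro ⟨h3, h4⟩
        exact ⟨⟨h3, h4 ▸ hf.2⟩, h4⟩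
    rw [h3]
    exact (Finset.mem_filter.1 hf).2.le
  have hc : H.card + (G.filter fun f => ¬ n < (G.filter fun g => g.1 = f.1).card).card = G.card :=
    Finset.card_filter_add_card_filter_not _
  obtain ⟨E, hEs, hEc⟩ := Finset.exists_subset_card_eq
    (s := G.filter fun f => ¬ n < (G.filter fun g => g.1 = f.1).card)
    (n := 2 * (h * m) + 1) (by lia)
  have hEG : E ⊆ G := hEs.trans (Finset.filter_subset _ _)
  have sP := Finset.card_le_card (Finset.image_subset_image (f := Prod.fst) hEG)
  have sW := Finset.card_le_card (Finset.image_subset_image (f := Prod.snd) hEG)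
  obtain ⟨E', hE', hne, d1, d2⟩ := exists_large_degrees h _ E rfl (by
    have := Nat.mul_le_mul_left h (Nat.add_le_add (sP.trans hP) (sW.trans hW))
    have h3 : h * (m + m) = 2 * (h * m) := by ring
    rw [h3, ← Nat.lt_add_one_iff, ← hEc] at this
    exact this)
  have key := pow_le_of_large_degrees (fun f hf => hG f (hEG (hE' hf))) hne (e := 3 * (h * m))
    (by have := Finset.card_le_card hE'; lia) hhn hn1
    ((Finset.card_le_card (Finset.image_subset_image hE')).trans (sP.trans hP))
    ((Finset.card_le_card (Finset.image_subset_image hE')).trans (sW.trans hW))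
    (fun f hf => by
      have h3 := (Finset.mem_filter.1 (hEs (hE' hf))).2
      have h4 := Finset.card_le_card
        (Finset.filter_subset_filter (fun g => g.1 = f.1) (hE'.trans hEG))
      lia) d1 d2
    (fun i hi hin => hchar i hi ((Nat.pow_le_pow_left hin 2).trans hn2))
  refine absurd hm (not_lt.2 ?_)
  have hn6 : (n ^ 3) ^ 2 ≤ (4 * (h * m)) ^ 3 := by
    rw [← pow_mul, mul_comm 3 2, pow_mul]
    exact Nat.pow_le_pow_left hn2 3
  have k1 := Nat.pow_le_pow_left key 2
  have k2 : (m * (3 * (h * m) * (252 * 93312 * n ^ 3 + n * n ^ 2))) ^ 2 =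
      9 * (252 * 93312 + 1) ^ 2 * m ^ 4 * h ^ 2 * (n ^ 3) ^ 2 := by ring
  rw [k2] at k1
  have k3 := k1.trans (Nat.mul_le_mul_left _ hn6)
  have hpos : 0 < h ^ 5 := Nat.pow_pos (by lia)
  refine le_of_mul_le_mul_left (a := h ^ 5) ?_ hpos
  calc h ^ 5 * h ^ 15 = ((h * (h * h * (h * h))) ^ 2) ^ 2 := by ring
    _ ≤ _ := k3
    _ = _ := by ring

end BalancedIncidences

section Distances

variable {F : Type*} [Field F]

theorem sqDist_ne_zero_of_bisector (two : (2 : F) ≠ 0) {q r r' : F × F} (hr : r' ≠ r)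
    (h : sqDist q r = sqDist q r') (h0 : sqDist q r ≠ 0) : sqDist r' r ≠ 0 := by
  obtain ⟨a, b⟩ := q
  obtain ⟨c, d⟩ := r
  obtain ⟨e, f⟩ := r'
  simp only [sqDist] at *
  intro h1
  have h4 : (a - c) * (e - c) + (b - d) * (f - d) = 0 :=
    mul_left_cancel₀ two (by linear_combination h + h1)
  have h2 : ((a - c) ^ 2 + (b - d) ^ 2) * (e - c) ^ 2 = 0 := by
    linear_combination ((a - c) * (e - c) - (b - d) * (f - d)) * h4 + (b - d) ^ 2 * h1
  have h3 : ((a - c) ^ 2 + (b - d) ^ 2) * (f - d) ^ 2 = 0 := by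
    linear_combination ((b - d) * (f - d) - (a - c) * (e - c)) * h4 + (a - c) ^ 2 * h1
  have h5 := pow_eq_zero_iff two_ne_zero |>.1 ((mul_eq_zero.1 h2).resolve_left h0)
  have h6 := pow_eq_zero_iff two_ne_zero |>.1 ((mul_eq_zero.1 h3).resolve_left h0)
  exact hr (Prod.ext (sub_eq_zero.1 h5) (sub_eq_zero.1 h6))

/-- The line equidistant from `r` and `r'`, in coordinates centred at `r`. -/
def bisector (r r' : F × F) : F × F :=
  (2 * (r'.1 - r.1) / sqDist r' r, 2 * (r'.2 - r.2) / sqDist r' r)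

theorem incident_bisector {q r r' : F × F} (h : sqDist q r = sqDist q r')
    (h0 : sqDist r' r ≠ 0) : Incident (q.1 - r.1, q.2 - r.2) (bisector r r') := by
  simp only [Incident, bisector]
  field_simp
  simp only [sqDist] at *
  linear_combination h

theorem bisector_injOn (h2 : (2 : F) ≠ 0) (r : F × F) :
    Set.InjOn (bisector r) {r' | sqDist r' r ≠ 0} := by
  intro a ha b hb h
  simp only [Set.mem_ofPred_eq] at ha hb
  simp only [bisector, Prod.mk.injEq] at h
  obtain ⟨h1, h3⟩ := h
  rw [div_eq_div_iff ha hb] at h1 h3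
  have e1 := mul_left_cancel₀ h2 (b := (a.1 - r.1) * sqDist b r) (c := (b.1 - r.1) * sqDist a r)
    (by linear_combination h1)
  have e2 := mul_left_cancel₀ h2 (b := (a.2 - r.2) * sqDist b r) (c := (b.2 - r.2) * sqDist a r)
    (by linear_combination h3)
  have e3 : sqDist a r * sqDist b r * (sqDist b r - sqDist a r) = 0 := by
    have k1 : sqDist a r = (a.1 - r.1) ^ 2 + (a.2 - r.2) ^ 2 := rfl
    have k2 : sqDist b r = (b.1 - r.1) ^ 2 + (b.2 - r.2) ^ 2 := rfl
    linear_combination ((a.1 - r.1) * sqDist b r + (b.1 - r.1) * sqDist a r) * e1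
      + ((a.2 - r.2) * sqDist b r + (b.2 - r.2) * sqDist a r) * e2
      + sqDist b r ^ 2 * k1 - sqDist a r ^ 2 * k2
  have e4 := sub_eq_zero.1 ((mul_eq_zero.1 e3).resolve_left (mul_ne_zero ha hb))
  rw [e4] at e1 e2
  ext
  · linear_combination mul_right_cancel₀ ha e1
  · linear_combination mul_right_cancel₀ ha e2

/-- Each point is the apex-side vertex of few isosceles triangles. -/
theorem card_isosceles_le {P : Finset (F × F)} {h : ℕ}
    (hm : 576 * (252 * 93312 + 1) ^ 2 * P.card ^ 7 < h ^ 15)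
    (h2 : 2 ≤ h) (hhm : h ≤ P.card)
    (hchar : ∀ i : ℕ, i ≠ 0 → i ^ 2 ≤ 4 * (h * P.card) → (i : F) ≠ 0) (r : F × F) :
    ((P ×ˢ P).filter fun x =>
      x.2 ≠ r ∧ sqDist x.1 r = sqDist x.1 x.2 ∧ sqDist x.1 r ≠ 0).card ≤ 4 * (h * P.card) := by
  have two : (2 : F) ≠ 0 := by
    have := hchar 2 (by simp) (by nlinarith)
    exact_mod_cast this
  let ψ : (F × F) × F × F → (F × F) × F × F := fun x =>
    ((x.1.1 - r.1, x.1.2 - r.2), bisector r x.2)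
  have h0 : ∀ x ∈ (P ×ˢ P).filter fun x =>
      x.2 ≠ r ∧ sqDist x.1 r = sqDist x.1 x.2 ∧ sqDist x.1 r ≠ 0,
      x.1 ∈ P ∧ x.2 ∈ P ∧ sqDist x.1 r = sqDist x.1 x.2 ∧ sqDist x.2 r ≠ 0 := by
    intro x hx
    obtain ⟨h1, h2, h3, h4⟩ := Finset.mem_filter.1 hx
    exact ⟨(Finset.mem_product.1 h1).1, (Finset.mem_product.1 h1).2, h3,
      sqDist_ne_zero_of_bisector two h2 h3 h4⟩
  rw [← Finset.card_image_of_injOn (f := ψ)]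
  · refine card_incident_le hm h2 hhm hchar ?_ ?_ ?_
    · intro f hf
      obtain ⟨x, hx, rfl⟩ := Finset.mem_image.1 hf
      exact incident_bisector (h0 x hx).2.2.1 (h0 x hx).2.2.2
    · refine (Finset.card_le_card (t := P.image fun q => (q.1 - r.1, q.2 - r.2)) ?_).trans
        Finset.card_image_le
      intro y hy
      obtain ⟨f, hf, rfl⟩ := Finset.mem_image.1 hy
      obtain ⟨x, hx, rfl⟩ := Finset.mem_image.1 hf
      exact Finset.mem_image.2 ⟨x.1, (h0 x hx).1, rfl⟩
    · refine (Finset.card_le_card (t := P.image fun q => bisector r q) ?_).trans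
        Finset.card_image_le
      intro y hy
      obtain ⟨f, hf, rfl⟩ := Finset.mem_image.1 hy
      obtain ⟨x, hx, rfl⟩ := Finset.mem_image.1 hf
      exact Finset.mem_image.2 ⟨x.2, (h0 x hx).2.1, rfl⟩
  · intro x hx y hy e
    simp only [ψ, Prod.mk.injEq] at e
    refine Prod.ext (Prod.ext ?_ ?_) (bisector_injOn two r (h0 x hx).2.2.2 (h0 y hy).2.2.2 e.2)
    · linear_combination e.1.1
    · linear_combination e.1.2

/-- An isotropic line contains few points if not all distances vanish. -/
theorem exists_pinned_of_isotropic (two : (2 : F) ≠ 0) {i κ : F} (hi : i ^ 2 = -1)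
    {P P' : Finset (F × F)} (hP : P' ⊆ P) (hne : P.Nonempty) (hd : allDists P ≠ {0})
    (h : ∀ z ∈ P', z.1 + i * z.2 = κ) : ∃ q ∈ P, P'.card ≤ (pinnedDists q P).card := by
  obtain ⟨q, hq, hqκ⟩ : ∃ q ∈ P, q.1 + i * q.2 ≠ κ := by
    by_contra! hc
    apply hd
    obtain ⟨x, hx⟩ := hne
    have hz : ∀ y ∈ P, ∀ z ∈ P, sqDist y z = 0 := fun y hy z hz => by
      have e := (hc y hy).trans (hc z hz).symm
      simp only [sqDist]
      linear_combination (y.1 - z.1 - i * (y.2 - z.2)) * e + (y.2 - z.2) ^ 2 * hi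
    ext d
    simp only [allDists, Finset.mem_image, Finset.mem_product, Finset.mem_singleton]
    constructor
    · rintro ⟨y, hy, rfl⟩
      exact hz _ hy.1 _ hy.2
    · rintro rfl
      exact ⟨(x, x), ⟨hx, hx⟩, hz x hx x hx⟩
  refine ⟨q, hq, Finset.card_le_card_of_injOn (sqDist q)
    (fun z hz => Finset.mem_image_of_mem _ (hP hz)) fun y hy z hz e => ?_⟩
  have hi0 : i ≠ 0 := by
    rintro rfl
    simp at hi
  have hy' := h y hy
  have hz' := h z hz
  have hfac : ∀ x : F × F, x.1 + i * x.2 = κ →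
      sqDist q x = (q.1 + i * q.2 - κ) * (q.1 - i * q.2 - x.1 + i * x.2) := fun x hx => by
    simp only [sqDist]
    linear_combination (-(q.1 - i * q.2 - x.1 + i * x.2)) * hx + (q.2 - x.2) ^ 2 * hi
  rw [hfac y hy', hfac z hz'] at e
  have e' := mul_left_cancel₀ (sub_ne_zero.2 hqκ) e
  ext
  · exact mul_left_cancel₀ two (by linear_combination hy' - hz' - e')
  · exact mul_left_cancel₀ (mul_ne_zero two hi0) (by linear_combination hy' - hz' + e')

end Distances

section Pinned

variable {F : Type*} [Field F]

/-- If many points are at distance zero from some point, a large pinned distance set exists. -/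
theorem exists_pinned_of_isotropic_cone (two : (2 : F) ≠ 0) {P : Finset (F × F)}
    (hne : P.Nonempty) (hd : (∃ i : F, i ^ 2 = -1) → allDists P ≠ {0}) (q : F × F)
    {Z : Finset (F × F)}
    (hZ : Z ⊆ P) (h : ∀ z ∈ Z, sqDist q z = 0) :
    ∃ q' ∈ P, Z.card ≤ 2 * (pinnedDists q' P).card := by
  by_cases hi : ∃ i : F, i ^ 2 = -1
  · obtain ⟨i, hi⟩ := hi
    have hsub : Z ⊆ Z.filter (fun z => z.1 + i * z.2 = q.1 + i * q.2) ∪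
        Z.filter (fun z => z.1 + -i * z.2 = q.1 + -i * q.2) := by
      intro z hz
      have e := h z hz
      have e' : (z.1 + i * z.2 - (q.1 + i * q.2)) * (z.1 + -i * z.2 - (q.1 + -i * q.2)) = 0 := by
        simp only [sqDist] at e
        linear_combination e - (q.2 - z.2) ^ 2 * hi
      rw [Finset.mem_union, Finset.mem_filter, Finset.mem_filter]
      rcases mul_eq_zero.1 e' with h | h
      · exact Or.inl ⟨hz, sub_eq_zero.1 h⟩
      · exact Or.inr ⟨hz, sub_eq_zero.1 h⟩
    have hc := (Finset.card_le_card hsub).trans (Finset.card_union_le _ _)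
    obtain ⟨a, ha, hca⟩ := exists_pinned_of_isotropic two hi ((Finset.filter_subset _ _).trans hZ)
      hne (hd ⟨i, hi⟩) (P' := Z.filter (fun z => z.1 + i * z.2 = q.1 + i * q.2))
      (fun z hz => (Finset.mem_filter.1 hz).2)
    obtain ⟨b, hb, hcb⟩ := exists_pinned_of_isotropic two (i := -i) (by rw [neg_sq, hi])
      ((Finset.filter_subset _ _).trans hZ)
      hne (hd ⟨i, hi⟩) (P' := Z.filter (fun z => z.1 + -i * z.2 = q.1 + -i * q.2))
      (fun z hz => (Finset.mem_filter.1 hz).2)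
    rcases le_total (pinnedDists a P).card (pinnedDists b P).card with hab | hab
    · exact ⟨b, hb, by omega⟩
    · exact ⟨a, ha, by omega⟩
  · have hz : Z ⊆ {q} := by
      intro z hz
      have e := h z hz
      simp only [sqDist] at e
      have h2 : q.2 - z.2 = 0 := by
        by_contra hc
        refine hi ⟨(q.1 - z.1) / (q.2 - z.2), ?_⟩
        field_simp
        linear_combination e
      have h1 : q.1 - z.1 = 0 := by
        rw [h2] at e
        simpa using e
      rw [Finset.mem_singleton]
      exact Prod.ext (sub_eq_zero.1 h1).symm (sub_eq_zero.1 h2).symm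
    obtain ⟨x, hx⟩ := hne
    have h1 : 1 ≤ (pinnedDists x P).card :=
      Finset.card_pos.2 ⟨_, Finset.mem_image_of_mem _ hx⟩
    have := Finset.card_le_card hz
    rw [Finset.card_singleton] at this
    exact ⟨x, hx, by omega⟩

/-- A lower bound for the largest pinned distance set. -/
theorem exists_card_le_mul_card_pinnedDists {P : Finset (F × F)} {h : ℕ}
    (hm : 576 * (252 * 93312 + 1) ^ 2 * P.card ^ 7 < h ^ 15)
    (h2 : 2 ≤ h) (hhm : h ≤ P.card)
    (hchar : ∀ i : ℕ, i ≠ 0 → i ^ 2 ≤ 4 * (h * P.card) → (i : F) ≠ 0)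
    (hd : (∃ i : F, i ^ 2 = -1) → allDists P ≠ {0}) :
    ∃ q ∈ P, P.card ≤ 20 * h * (pinnedDists q P).card := by
  have two : (2 : F) ≠ 0 := by
    have := hchar 2 (by simp) (by nlinarith)
    exact_mod_cast this
  have hne : P.Nonempty := Finset.card_pos.1 (by omega)
  by_cases hz : ∃ q ∈ P, P.card < 2 * (P.filter fun r => sqDist q r = 0).card
  · obtain ⟨q, hq, hz⟩ := hz
    obtain ⟨a, ha, hc⟩ := exists_pinned_of_isotropic_cone two hne hd q
      (Finset.filter_subset (fun r => sqDist q r = 0) P) (fun z hz => (Finset.mem_filter.1 hz).2)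
    exact ⟨a, ha, by nlinarith⟩
  push Not at hz
  by_contra! hc
  let N : F × F → Finset (F × F) := fun q => P.filter fun r => sqDist q r ≠ 0
  let E : F × F → Finset ((F × F) × F × F) := fun q =>
    (N q ×ˢ N q).filter fun x => sqDist q x.1 = sqDist q x.2
  have hN : ∀ q ∈ P, P.card ≤ 2 * (N q).card := fun q hq => by
    have := hz q hq
    have h3 := Finset.card_filter_add_card_filter_not (s := P) (fun r => sqDist q r = 0)
    simp only [N]
    simp only [ne_eq] at *
    omega
  have hE : ∀ q ∈ P, (N q).card ^ 2 ≤ (pinnedDists q P).card * (E q).card := fun q _ =>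
    sq_card_le_card_mul_card_pairs (N q) (sqDist q) _
      fun j hj => Finset.mem_image_of_mem _ (Finset.mem_filter.1 hj).1
  have hsum : ∑ q ∈ P, (E q).card ≤ 5 * h * P.card ^ 2 := by
    have hI := fun r => card_isosceles_le hm h2 hhm hchar r
    have hle : ∀ r, ((P ×ˢ P).filter fun x =>
        sqDist x.1 r = sqDist x.1 x.2 ∧ sqDist x.1 r ≠ 0).card ≤ 5 * h * P.card := fun r => by
      have hs : ((P ×ˢ P).filter fun x => sqDist x.1 r = sqDist x.1 x.2 ∧ sqDist x.1 r ≠ 0) ⊆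
          ((P ×ˢ P).filter fun x =>
            x.2 ≠ r ∧ sqDist x.1 r = sqDist x.1 x.2 ∧ sqDist x.1 r ≠ 0) ∪
          P.image fun q => (q, r) := by
        intro x hx
        obtain ⟨hx, h4⟩ := Finset.mem_filter.1 hx
        by_cases hr : x.2 = r
        · refine Finset.mem_union_right _
            (Finset.mem_image.2 ⟨x.1, (Finset.mem_product.1 hx).1, ?_⟩)
          rw [← hr]
        · exact Finset.mem_union_left _ (Finset.mem_filter.2 ⟨hx, hr, h4⟩)
      have h5 := (Finset.card_le_card hs).trans (Finset.card_union_le _ _)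
      have h6 : (P.image fun q => (q, r)).card ≤ P.card := Finset.card_image_le
      have := hI r
      nlinarith
    have hEc : ∀ q ∈ P, (E q).card = ∑ r ∈ P, (P.filter fun r' =>
        sqDist q r = sqDist q r' ∧ sqDist q r ≠ 0).card := fun q _ => by
      have h7 : E q = (P ×ˢ P).filter fun x => sqDist q x.1 = sqDist q x.2 ∧ sqDist q x.1 ≠ 0 := by
        ext x
        simp only [E, N, Finset.mem_filter, Finset.mem_product]
        constructor
        · tauto
        · rintro ⟨⟨h1, h2⟩, h3, h4⟩
          exact ⟨⟨⟨h1, h4⟩, h2, h3 ▸ h4⟩, h3⟩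
      rw [h7, Finset.card_filter, Finset.sum_product]
      exact Finset.sum_congr rfl fun r _ => (Finset.card_filter _ _).symm
    rw [Finset.sum_congr rfl hEc, Finset.sum_comm]
    calc _ ≤ ∑ r ∈ P, 5 * h * P.card := Finset.sum_le_sum fun r _ => by
            refine le_trans (le_of_eq ?_) (hle r)
            rw [Finset.card_filter, Finset.sum_product]
            exact Finset.sum_congr rfl fun q _ => Finset.card_filter _ _
      _ = _ := by rw [Finset.sum_const, smul_eq_mul]; ring
  have hlt : ∑ q ∈ P, 5 * h * P.card ^ 2 < ∑ q ∈ P, P.card * (E q).card := by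
    refine Finset.sum_lt_sum_of_nonempty hne fun q hq => ?_
    have h8 := hN q hq
    have h9 := hE q hq
    have h10 := hc q hq
    have h11 : P.card ^ 2 ≤ 4 * (N q).card ^ 2 := by nlinarith
    have h12 : 0 < (E q).card := by
      rcases Nat.eq_zero_or_pos (E q).card with h0 | h0
      · rw [h0] at h9
        nlinarith [hne.card_pos]
      · exact h0
    nlinarith [Nat.mul_lt_mul_of_pos_right h10 h12,
      Nat.mul_le_mul_left (5 * h) (h11.trans (Nat.mul_le_mul_left 4 h9))]
  rw [Finset.sum_const, smul_eq_mul, ← Finset.mul_sum] at hlt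
  exact absurd hsum (not_le.2 (Nat.lt_of_mul_lt_mul_left hlt))

end Pinned

theorem exists_card_pinnedDists_ge {F : Type*} [Field F] {P : Finset (F × F)} (hne : P.Nonempty)
    (hp : ∀ p : ℕ, p.Prime → CharP F p →
      (P.card : ℝ) ≤ 1 / 100 * (p : ℝ) ^ ((15 : ℝ) / 11))
    (hd : (∃ i : F, i ^ 2 = -1) → allDists P ≠ {0}) :
    ∃ q ∈ P, 1 / 420 * (P.card : ℝ) ^ ((8 : ℝ) / 15) ≤ ((pinnedDists q P).card : ℝ) := by
  obtain ⟨m, hmP⟩ : ∃ m, m = P.card := ⟨_, rfl⟩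
  rw [← hmP] at hp ⊢
  have hm1 : (1 : ℝ) ≤ m := by
    have := hne.card_pos
    exact_mod_cast (hmP ▸ this : 0 < m)
  have hm0 : (0 : ℝ) < m := by linarith
  obtain ⟨x, hx⟩ : ∃ x, x = (m : ℝ) ^ ((7 : ℝ) / 15) := ⟨_, rfl⟩
  obtain ⟨y, hy⟩ : ∃ y, y = (m : ℝ) ^ ((8 : ℝ) / 15) := ⟨_, rfl⟩
  have hx1 : 1 ≤ x := hx ▸ Real.one_le_rpow hm1 (by norm_num)
  have hxy : x * y = m := by
    rw [hx, hy, ← Real.rpow_add hm0]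
    norm_num
  have hx15 : x ^ 15 = (m : ℝ) ^ 7 := by
    rw [hx, ← Real.rpow_natCast, ← Real.rpow_mul hm0.le, ← Real.rpow_natCast]
    norm_num
  obtain ⟨h, hh⟩ : ∃ h, h = ⌈20 * x⌉₊ := ⟨_, rfl⟩
  have hl : 20 * x ≤ h := hh ▸ Nat.le_ceil _
  have hu : (h : ℝ) ≤ 21 * x := by
    have := Nat.ceil_lt_add_one (by linarith : 0 ≤ 20 * x)
    rw [← hh] at this
    linarith
  rw [← hy]
  by_cases hhm : h ≤ m
  · obtain ⟨q, hq, hc⟩ := exists_card_le_mul_card_pinnedDists (P := P) (h := h) (by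
        rw [← hmP]
        have h1 : (20 * x) ^ 15 ≤ (h : ℝ) ^ 15 := pow_le_pow_left₀ (by linarith) hl 15
        rw [mul_pow, hx15] at h1
        have h2 : (0 : ℝ) < (m : ℝ) ^ 7 := by positivity
        have h3 : (576 * (252 * 93312 + 1) ^ 2 * (m : ℝ) ^ 7) < (h : ℝ) ^ 15 := by
          norm_num at h1 ⊢
          linarith
        exact_mod_cast h3) (by
        have : (2 : ℝ) ≤ h := by linarith
        exact_mod_cast this) (hmP ▸ hhm) (by
        rw [← hmP]
        intro i hi hi2 h0
        obtain ⟨p, hcp⟩ := CharP.exists F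
        have hdvd := (CharP.cast_eq_zero_iff F p i).1 h0
        have hp0 : p ≠ 0 := by
          rintro rfl
          exact hi (zero_dvd_iff.1 hdvd)
        have hpp : p.Prime := (CharP.char_is_prime_or_zero F p).resolve_right hp0
        have hpi : p ≤ i := Nat.le_of_dvd (Nat.pos_of_ne_zero hi) hdvd
        have h4 : p ^ 2 ≤ 4 * (h * m) := (Nat.pow_le_pow_left hpi 2).trans hi2
        have h5 : (p : ℝ) ^ 2 ≤ 4 * (h * m) := by exact_mod_cast h4
        have hpR : (0 : ℝ) < p := by exact_mod_cast hpp.pos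
        have h6 : x * m ≤ 1 / 100 * (p : ℝ) ^ 2 := by
          have e1 : x * m = (m : ℝ) ^ ((22 : ℝ) / 15) := by
            rw [hx]
            nth_rewrite 2 [← Real.rpow_one (m : ℝ)]
            rw [← Real.rpow_add hm0]
            norm_num
          have e2 : ((p : ℝ) ^ ((15 : ℝ) / 11)) ^ ((22 : ℝ) / 15) = (p : ℝ) ^ 2 := by
            rw [← Real.rpow_mul hpR.le, ← Real.rpow_natCast]
            norm_num
          rw [e1, ← e2]
          refine (Real.rpow_le_rpow hm0.le (hp p hpp hcp) (by norm_num)).trans ?_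
          rw [Real.mul_rpow (by norm_num) (by positivity)]
          gcongr
          exact Real.rpow_le_self_of_le_one (by norm_num) (by norm_num) (by norm_num)
        have h7 : (h : ℝ) * m ≤ 21 * x * m := mul_le_mul_of_nonneg_right hu hm0.le
        have h8 : (0 : ℝ) < (p : ℝ) ^ 2 := by positivity
        nlinarith) hd
    refine ⟨q, hq, ?_⟩
    rw [← hmP] at hc
    have hcR : (m : ℝ) ≤ 20 * h * (pinnedDists q P).card := by exact_mod_cast hc
    have h9 : x * y ≤ x * (420 * (pinnedDists q P).card) := by
      have := mul_le_mul_of_nonneg_right hu (Nat.cast_nonneg (α := ℝ) (pinnedDists q P).card)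
      nlinarith
    linarith [le_of_mul_le_mul_left h9 (by linarith)]
  · obtain ⟨q, hq⟩ := hne
    refine ⟨q, hq, ?_⟩
    have h1 : 1 ≤ (pinnedDists q P).card :=
      Finset.card_pos.2 ⟨_, Finset.mem_image_of_mem _ hq⟩
    have h1R : (1 : ℝ) ≤ (pinnedDists q P).card := by exact_mod_cast h1
    have h2 : (m : ℝ) < h := by exact_mod_cast not_le.1 hhm
    have h3 : x * y < x * 21 := by linarith
    linarith [lt_of_mul_lt_mul_left h3 (by linarith)]

theorem stmt_13 :
    ∃ c C : ℝ, 0 < c ∧ 0 < C ∧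
      ∀ (F : Type) [Field F] (P : Finset (F × F)) (m : ℕ),
        P.card = m → P.Nonempty →
        (∀ p : ℕ, p.Prime → CharP F p → (m : ℝ) ≤ c * (p : ℝ) ^ ((15 : ℝ) / 11)) →
        ((∃ i : F, i ^ 2 = -1) → allDists P ≠ {0}) →
        (∃ q ∈ P, C * (m : ℝ) ^ ((8 : ℝ) / 15) ≤ ((pinnedDists q P).card : ℝ)) ∧
          C * (m : ℝ) ^ ((8 : ℝ) / 15) ≤ ((allDists P).card : ℝ) := by
  refine ⟨1 / 100, 1 / 420, by norm_num, by norm_num, ?_⟩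
  rintro F _ P m rfl hne hp hd
  obtain ⟨q, hq, h⟩ := exists_card_pinnedDists_ge hne hp hd
  refine ⟨⟨q, hq, h⟩, h.trans ?_⟩
  have hsub : pinnedDists q P ⊆ allDists P := by
    intro d hd
    obtain ⟨r, hr, rfl⟩ := Finset.mem_image.1 hd
    exact Finset.mem_image.2 ⟨(q, r), Finset.mem_product.2 ⟨hq, hr⟩, rfl⟩
  exact_mod_cast Finset.card_le_card hsub
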